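/- arXiv:2210.04322 — 13 statements merged into one kernel-verified Lean document; each statement's English description precedes it below -/
import Mathlib

section
/- For every natural number n, the Fibonacci number F_{2n} satisfies F_{2n} = Σ_{k=1}^{n} C(2n, n+k) · (k/5), where (k/5) denotes the Legendre symbol modulo 5 (equal to 0 if k ≡ 0 mod 5, to 1 if k ≡ 1 or 4 mod 5, and to −1 if k ≡ 2 or 3 mod 5). -/
/-- The Legendre symbol modulo 5. -/
def leg5 (k : ℕ) : ℤ :=
  if k % 5 = 0 then 0 else if k % 5 = 1 ∨ k % 5 = 4 then 1 else -1

open Finset in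
/-- Summation by parts for the second-order operator `g ↦ g (k - 1) + 2 g k + g (k + 1)`. -/
theorem sum_range_binomial_two_mul_by_parts (c f : ℕ → ℤ) (m : ℕ) :
    ∑ k ∈ range m, (c k + 2 * c (k + 1) + c (k + 2)) * f (k + 1) + c 1 * f 0 =
      ∑ k ∈ range m, c (k + 1) * (f k + 2 * f (k + 1) + f (k + 2)) + c 0 * f 1 +
        (c (m + 1) * f m - c m * f (m + 1)) := by
  induction m with
  | zero => simp
  | succ m ih =>
    rw [sum_range_succ, sum_range_succ]
    linear_combination ih

theorem choose_two_mul_succ_cast (n k : ℕ) :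
    ((2 * (n + 1)).choose (n + 1 + (k + 1)) : ℤ) =
      (2 * n).choose (n + k) + 2 * (2 * n).choose (n + (k + 1)) + (2 * n).choose (n + (k + 2)) := by
  rw [show 2 * (n + 1) = 2 * n + 1 + 1 by ring, show n + 1 + (k + 1) = n + k + 1 + 1 by ring,
    Nat.choose_succ_succ, Nat.choose_succ_succ, Nat.choose_succ_succ (2 * n) (n + k + 1)]
  push_cast [Nat.succ_eq_add_one, add_assoc]
  ring

theorem centralBinom_succ_cast (n : ℕ) :
    ((2 * (n + 1)).choose (n + 1) : ℤ) = 2 * (2 * n).choose n + 2 * (2 * n).choose (n + 1) := by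
  have h : (2 * n + 1).choose n = (2 * n + 1).choose (n + 1) :=
    (Nat.choose_symm_half n).symm
  rw [show 2 * (n + 1) = 2 * n + 1 + 1 by ring, Nat.choose_succ_succ, h, Nat.choose_succ_succ]
  push_cast
  ring

open Finset in
theorem sum_choose_two_mul_succ (f : ℕ → ℤ) {n m : ℕ} (h : n < m) :
    ∑ k ∈ range m, ((2 * (n + 1)).choose (n + 1 + (k + 1)) : ℤ) * f (k + 1) +
        (2 * n).choose (n + 1) * f 0 =
      ∑ k ∈ range m, ((2 * n).choose (n + (k + 1)) : ℤ) * (f k + 2 * f (k + 1) + f (k + 2)) +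
        (2 * n).choose n * f 1 := by
  have key := sum_range_binomial_two_mul_by_parts (fun k => ((2 * n).choose (n + k) : ℤ)) f m
  have h₀ : (2 * n).choose (n + m) = 0 := Nat.choose_eq_zero_of_lt (by omega)
  have h₁ : (2 * n).choose (n + (m + 1)) = 0 := Nat.choose_eq_zero_of_lt (by omega)
  simp only [h₀, h₁, Nat.cast_zero, zero_mul, sub_zero, add_zero] at key
  simpa only [choose_two_mul_succ_cast] using key

/-- The values `χ (k - 1) + 2 χ k + χ (k + 1)` for the Legendre symbol `χ` modulo 5. -/
def leg5Smooth (k : ℕ) : ℤ :=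
  if k % 5 = 0 then 2 else if k % 5 = 1 ∨ k % 5 = 4 then 1 else -2

theorem leg5_add_two_mul_add (k : ℕ) :
    leg5 k + 2 * leg5 (k + 1) + leg5 (k + 2) = leg5Smooth (k + 1) := by
  unfold leg5 leg5Smooth
  have : k % 5 < 5 := Nat.mod_lt _ (by norm_num)
  rw [Nat.add_mod k 1, Nat.add_mod k 2]
  interval_cases k % 5 <;> simp

theorem leg5Smooth_add_two_mul_add (k : ℕ) :
    leg5Smooth k + 2 * leg5Smooth (k + 1) + leg5Smooth (k + 2) =
      3 * leg5Smooth (k + 1) - leg5 (k + 1) := by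
  unfold leg5 leg5Smooth
  have : k % 5 < 5 := Nat.mod_lt _ (by norm_num)
  rw [Nat.add_mod k 1, Nat.add_mod k 2]
  interval_cases k % 5 <;> simp

open Finset in
theorem sum_choose_leg5_recurrence {n m : ℕ} (h : n + 1 < m) :
    ∑ k ∈ range m, ((2 * (n + 2)).choose (n + 2 + (k + 1)) : ℤ) * leg5 (k + 1) =
      3 * ∑ k ∈ range m, ((2 * (n + 1)).choose (n + 1 + (k + 1)) : ℤ) * leg5 (k + 1) -
        ∑ k ∈ range m, ((2 * n).choose (n + (k + 1)) : ℤ) * leg5 (k + 1) := by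
  have e₁ := sum_choose_two_mul_succ leg5 h
  have e₂ := sum_choose_two_mul_succ leg5 (Nat.lt_of_succ_lt h)
  have e₃ := sum_choose_two_mul_succ leg5Smooth (Nat.lt_of_succ_lt h)
  have hc := centralBinom_succ_cast n
  simp only [leg5_add_two_mul_add, leg5Smooth_add_two_mul_add, mul_sub, sum_sub_distrib,
    mul_left_comm _ (3 : ℤ), ← mul_sum, show leg5 0 = 0 from rfl, show leg5 1 = 1 from rfl,
    show leg5Smooth 0 = 2 from rfl, show leg5Smooth 1 = 1 from rfl] at e₁ e₂ e₃
  linear_combination e₁ - 3 * e₂ + e₃ + hc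

open Finset in
theorem fib_two_mul_eq_sum_range (n : ℕ) : ∀ m, n ≤ m → (Nat.fib (2 * n) : ℤ) =
    ∑ k ∈ range m, ((2 * n).choose (n + (k + 1)) : ℤ) * leg5 (k + 1) := by
  suffices H : ∀ m, n + 1 ≤ m → (Nat.fib (2 * n) : ℤ) =
      ∑ k ∈ range m, ((2 * n).choose (n + (k + 1)) : ℤ) * leg5 (k + 1) by
    intro m hm
    have := H (m + 1) (by omega)
    rwa [sum_range_succ, Nat.choose_eq_zero_of_lt (by omega), Nat.cast_zero, zero_mul,
      add_zero] at this
  induction n using Nat.twoStepInduction with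
  | zero => simp
  | one =>
    intro m hm
    obtain ⟨m, rfl⟩ : ∃ l, m = l + 1 := ⟨m - 1, by omega⟩
    rw [sum_range_succ', sum_eq_zero]
    · rfl
    · intro k _
      rw [Nat.choose_eq_zero_of_lt (by omega)]
      simp
  | more n ih₀ ih₁ =>
    intro m hm
    rw [sum_choose_leg5_recurrence (by omega), ← ih₀ m (by omega), ← ih₁ m (by omega)]
    have a := Nat.fib_add_two (n := 2 * n)
    have b := Nat.fib_add_two (n := 2 * n + 1)
    have c := Nat.fib_add_two (n := 2 * n + 2)
    simp only [mul_add, mul_one, add_assoc, Nat.reduceAdd, Nat.reduceMul] at *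
    omega

theorem fib_two_mul_eq_sum_choose_leg5 (n : ℕ) :
    (Nat.fib (2 * n) : ℤ) =
      ∑ k ∈ Finset.Icc 1 n, (Nat.choose (2 * n) (n + k) : ℤ) * leg5 k := by
  rw [fib_two_mul_eq_sum_range n n le_rfl, Finset.range_eq_Ico,
    Finset.sum_Ico_add' (fun k => (Nat.choose (2 * n) (n + k) : ℤ) * leg5 k) 0 n 1]
  rfl
end

section
/- For every natural number n, the Fibonacci number F_{2n+1} satisfies F_{2n+1} = − Σ_{k=1}^{n+1} C(2n+1, n+k) · ((k+2)/5), where ((k+2)/5) denotes the Legendre symbol modulo 5. -/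
theorem leg5_congr {a b : ℕ} (h : a % 5 = b % 5) : leg5 a = leg5 b := by
  simp only [leg5, h]

theorem leg5_eq_of_five_dvd_add {a b : ℕ} (h : (a + b) % 5 = 0) : leg5 a = leg5 b := by
  unfold leg5
  split_ifs <;> omega

/-- The binomial transform of length `m` of `leg5`, shifted by `a`. -/
def chooseLeg5Sum (m a : ℕ) : ℤ :=
  ∑ j ∈ Finset.range (m + 1), (Nat.choose m j : ℤ) * leg5 (j + a)

theorem chooseLeg5Sum_congr (m : ℕ) {a b : ℕ} (h : a % 5 = b % 5) :
    chooseLeg5Sum m a = chooseLeg5Sum m b :=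
  Finset.sum_congr rfl fun j _ => by rw [leg5_congr (show (j + a) % 5 = (j + b) % 5 by omega)]

theorem chooseLeg5Sum_succ (m a : ℕ) :
    chooseLeg5Sum (m + 1) a = chooseLeg5Sum m a + chooseLeg5Sum m (a + 1) := by
  have h : chooseLeg5Sum m a =
      ∑ j ∈ Finset.range (m + 2), (Nat.choose m j : ℤ) * leg5 (j + a) := by
    simp [chooseLeg5Sum, Finset.sum_range_succ _ (m + 1)]
  rw [h, chooseLeg5Sum, chooseLeg5Sum, Finset.sum_range_succ', Finset.sum_range_succ' _ (m + 1),
    add_right_comm, ← Finset.sum_add_distrib]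
  simp only [Nat.choose_succ_succ, Nat.choose_zero_right, Nat.cast_add]
  congr 1
  refine Finset.sum_congr rfl fun j _ => ?_
  rw [show j + (a + 1) = j + 1 + a by ring]
  ring

theorem chooseLeg5Sum_add_two (m a : ℕ) :
    chooseLeg5Sum (m + 2) a =
      chooseLeg5Sum m a + 2 * chooseLeg5Sum m (a + 1) + chooseLeg5Sum m (a + 2) := by
  rw [chooseLeg5Sum_succ, chooseLeg5Sum_succ, chooseLeg5Sum_succ]
  ring

/-- The odd-length transforms, centred modulo 5 (note `4 * n ≡ -n`), are Fibonacci numbers. -/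
theorem chooseLeg5Sum_odd (n : ℕ) :
    chooseLeg5Sum (2 * n + 1) (4 * n) = Nat.fib (2 * n + 2) ∧
    chooseLeg5Sum (2 * n + 1) (4 * n + 1) = -Nat.fib (2 * n) ∧
    chooseLeg5Sum (2 * n + 1) (4 * n + 2) = -2 * Nat.fib (2 * n + 1) ∧
    chooseLeg5Sum (2 * n + 1) (4 * n + 3) = -Nat.fib (2 * n) ∧
    chooseLeg5Sum (2 * n + 1) (4 * n + 4) = Nat.fib (2 * n + 2) := by
  induction n with
  | zero => decide
  | succ n ih =>
    obtain ⟨h0, h1, h2, h3, h4⟩ := ih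
    have per (a : ℕ) : chooseLeg5Sum (2 * n + 1) (4 * n + (a + 5)) =
        chooseLeg5Sum (2 * n + 1) (4 * n + a) := chooseLeg5Sum_congr _ (by omega)
    have h5 := (per 0).trans h0
    have h6 := (per 1).trans h1
    have h7 := (per 2).trans h2
    have h8 := (per 3).trans h3
    have h9 := (per 4).trans h4
    have h10 := (per 5).trans h5
    have f2 : (Nat.fib (2 * n + 2) : ℤ) = Nat.fib (2 * n) + Nat.fib (2 * n + 1) := by
      exact_mod_cast Nat.fib_add_two
    have f3 : (Nat.fib (2 * n + 3) : ℤ) = Nat.fib (2 * n + 1) + Nat.fib (2 * n + 2) := by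
      exact_mod_cast Nat.fib_add_two
    have f4 : (Nat.fib (2 * n + 4) : ℤ) = Nat.fib (2 * n + 2) + Nat.fib (2 * n + 3) := by
      exact_mod_cast Nat.fib_add_two
    simp only [chooseLeg5Sum_add_two, mul_add,
      add_assoc, Nat.reduceAdd, Nat.reduceMul] at *
    refine ⟨?_, ?_, ?_, ?_, ?_⟩ <;> linarith

theorem chooseLeg5Sum_odd_eq_two_mul (n : ℕ) :
    chooseLeg5Sum (2 * n + 1) (4 * n + 2) =
      2 * ∑ k ∈ Finset.Icc 1 (n + 1), (Nat.choose (2 * n + 1) (n + k) : ℤ) * leg5 (k + 2) := by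
  have hIcc : ∑ k ∈ Finset.Icc 1 (n + 1), (Nat.choose (2 * n + 1) (n + k) : ℤ) * leg5 (k + 2) =
      ∑ i ∈ Finset.range (n + 1),
        (Nat.choose (2 * n + 1) (n + (1 + i)) : ℤ) * leg5 (1 + i + 2) := by
    rw [← Finset.Ico_add_one_right_eq_Icc, Finset.sum_Ico_eq_sum_range, Nat.add_sub_cancel]
  rw [hIcc, chooseLeg5Sum, show 2 * n + 1 + 1 = (n + 1) + (n + 1) by ring,
    Finset.sum_range_add, two_mul (_ : ℤ)]
  congr 1
  · rw [← Finset.sum_range_reflect]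
    refine Finset.sum_congr rfl fun i hi => ?_
    have hi : i < n + 1 := Finset.mem_range.mp hi
    rw [Nat.choose_symm_of_eq_add (show 2 * n + 1 = (n + 1 - 1 - i) + (n + (1 + i)) by omega),
      leg5_eq_of_five_dvd_add
        (show (n + 1 - 1 - i + (4 * n + 2) + (1 + i + 2)) % 5 = 0 by omega)]
  · refine Finset.sum_congr rfl fun i _ => ?_
    rw [show n + 1 + i = n + (1 + i) by ring,
      leg5_congr (show (n + (1 + i) + (4 * n + 2)) % 5 = (1 + i + 2) % 5 by omega)]

theorem fib_odd_eq_neg_sum_choose_leg5 (n : ℕ) :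
    (Nat.fib (2 * n + 1) : ℤ) =
      - ∑ k ∈ Finset.Icc 1 (n + 1),
          (Nat.choose (2 * n + 1) (n + k) : ℤ) * leg5 (k + 2) := by
  have h := (chooseLeg5Sum_odd n).2.2.1
  rw [chooseLeg5Sum_odd_eq_two_mul] at h
  linarith
end

section
/- For every natural number n ≥ 1, the Lucas number L_{2n} satisfies L_{2n} = 5·C(2n−1, n) − 2^{2n−1} + 5·Σ_{j=1}^{⌊n/5⌋} C(2n, n+5j). -/
/-- The Lucas numbers: `L 0 = 2`, `L 1 = 1`, `L (n+2) = L (n+1) + L n`. -/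
def lucas : ℕ → ℕ
  | 0 => 2
  | 1 => 1
  | n + 2 => lucas (n + 1) + lucas n

/-- The sum of the binomial coefficients `C(m, k)` over all `k` in the residue class `r` mod 5. -/
def chooseSumMod (m : ℕ) (r : ZMod 5) : ℤ :=
  ∑ k ∈ Finset.range (m + 1), if (k : ZMod 5) = r then (m.choose k : ℤ) else 0

theorem chooseSumMod_succ (m : ℕ) (r : ZMod 5) :
    chooseSumMod (m + 1) r = chooseSumMod m r + chooseSumMod m (r - 1) := by
  have h : chooseSumMod m r =
      ∑ k ∈ Finset.range (m + 2), if (k : ZMod 5) = r then (m.choose k : ℤ) else 0 := by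
    rw [Finset.sum_range_succ, Nat.choose_succ_self]
    simp [chooseSumMod]
  rw [h, chooseSumMod, chooseSumMod, Finset.sum_range_succ', Finset.sum_range_succ' _ (m + 1),
    add_right_comm, ← Finset.sum_add_distrib]
  congr 1
  · refine Finset.sum_congr rfl fun k _ => ?_
    simp only [eq_sub_iff_add_eq, Nat.cast_add, Nat.cast_one, Nat.choose_succ_succ']
    split_ifs <;> ring
  · simp

theorem chooseSumMod_add_two (m : ℕ) (r : ZMod 5) :
    chooseSumMod (m + 2) (r + 1) =
      chooseSumMod m (r + 1) + 2 * chooseSumMod m r + chooseSumMod m (r - 1) := by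
  rw [chooseSumMod_succ, chooseSumMod_succ, chooseSumMod_succ, add_sub_cancel_right]
  ring

theorem five_mul_chooseSumMod_two_mul (n : ℕ) :
    5 * chooseSumMod (2 * n) n = 4 ^ n + 2 * lucas (2 * n) ∧
    5 * chooseSumMod (2 * n) (n + 1) = 4 ^ n + lucas (2 * n + 1) - lucas (2 * n) ∧
    5 * chooseSumMod (2 * n) (n - 1) = 4 ^ n + lucas (2 * n + 1) - lucas (2 * n) ∧
    5 * chooseSumMod (2 * n) (n + 2) = 4 ^ n - lucas (2 * n + 1) ∧
    5 * chooseSumMod (2 * n) (n - 2) = 4 ^ n - lucas (2 * n + 1) := by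
  induction n with
  | zero => decide
  | succ n ih =>
    obtain ⟨h0, h1, h2, h3, h4⟩ := ih
    have five : (5 : ZMod 5) = 0 := rfl
    have e0 := chooseSumMod_add_two (2 * n) n
    have e1 := chooseSumMod_add_two (2 * n) (n + 1)
    have e2 := chooseSumMod_add_two (2 * n) (n - 1)
    have e3 := chooseSumMod_add_two (2 * n) (n + 2)
    have e4 := chooseSumMod_add_two (2 * n) (n - 2)
    rw [show (n : ZMod 5) + 1 + 1 = n + 2 by ring, add_sub_cancel_right] at e1
    rw [sub_add_cancel, show (n : ZMod 5) - 1 - 1 = n - 2 by ring] at e2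
    rw [show (n : ZMod 5) + 2 + 1 = n - 2 by linear_combination five,
      show (n : ZMod 5) + 2 - 1 = n + 1 by ring] at e3
    rw [show (n : ZMod 5) - 2 + 1 = n - 1 by ring,
      show (n : ZMod 5) - 2 - 1 = n + 2 by linear_combination -five] at e4
    have l2 : (lucas (2 * n + 2) : ℤ) = lucas (2 * n + 1) + lucas (2 * n) := by
      simp [lucas]
    have l3 : (lucas (2 * n + 2 + 1) : ℤ) = lucas (2 * n + 2) + lucas (2 * n + 1) := by
      simp [lucas]
    rw [mul_add_one, Nat.cast_add_one, show (n : ZMod 5) + 1 + 1 = n + 2 by ring,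
      show (n : ZMod 5) + 1 - 1 = n by ring,
      show (n : ZMod 5) + 1 + 2 = n - 2 by linear_combination five,
      show (n : ZMod 5) + 1 - 2 = n - 1 by ring, pow_succ]
    refine ⟨?_, ?_, ?_, ?_, ?_⟩ <;> linarith

theorem chooseSumMod_two_mul_self (n : ℕ) :
    chooseSumMod (2 * n) n = (2 * n).choose n +
      2 * ∑ j ∈ Finset.Icc 1 (n / 5), ((2 * n).choose (n + 5 * j) : ℤ) := by
  have upper : ∑ k ∈ Finset.range n,
      (if ((n + (k + 1) : ℕ) : ZMod 5) = n then ((2 * n).choose (n + (k + 1)) : ℤ) else 0) =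
      ∑ j ∈ Finset.Icc 1 (n / 5), ((2 * n).choose (n + 5 * j) : ℤ) := by
    rw [← Finset.sum_filter]
    have key (k : ℕ) : ((n + (k + 1) : ℕ) : ZMod 5) = n ↔ 5 ∣ k + 1 := by
      rw [← ZMod.natCast_eq_zero_iff, Nat.cast_add, add_eq_left]
    simp only [key]
    refine Finset.sum_nbij' (fun k => (k + 1) / 5) (fun j => 5 * j - 1) ?_ ?_ ?_ ?_ ?_
    · intro k hk
      simp only [Finset.mem_filter, Finset.mem_range, Finset.mem_Icc] at *
      omega
    · intro j hj
      simp only [Finset.mem_filter, Finset.mem_range, Finset.mem_Icc] at *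
      omega
    · intro k hk
      simp only [Finset.mem_filter, Finset.mem_range] at *
      omega
    · intro j hj
      simp only [Finset.mem_Icc] at *
      omega
    · intro k hk
      simp only [Finset.mem_filter, Finset.mem_range] at *
      rw [Nat.mul_div_cancel' hk.2]
  have lower : ∑ k ∈ Finset.range n,
      (if (k : ZMod 5) = n then ((2 * n).choose k : ℤ) else 0) =
      ∑ k ∈ Finset.range n,
      (if ((n + (k + 1) : ℕ) : ZMod 5) = n then ((2 * n).choose (n + (k + 1)) : ℤ) else 0) := by
    rw [← Finset.sum_range_reflect]
    refine Finset.sum_congr rfl fun k hk => ?_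
    obtain ⟨d, rfl⟩ := Nat.exists_eq_add_of_lt (Finset.mem_range.mp hk)
    rw [show k + d + 1 - 1 - k = d by omega,
      Nat.choose_symm_of_eq_add (show 2 * (k + d + 1) = d + (k + d + 1 + (k + 1)) by ring)]
    refine if_congr ?_ rfl rfl
    push_cast
    constructor <;> intro h <;> linear_combination -h
  rw [chooseSumMod, show 2 * n + 1 = n + (n + 1) by ring, Finset.sum_range_add,
    Finset.sum_range_succ', lower, upper]
  simp only [add_zero, if_true]
  ring

theorem lucas_two_mul_eq (n : ℕ) (hn : 1 ≤ n) :
    (lucas (2 * n) : ℤ) =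
      5 * Nat.choose (2 * n - 1) n - 2 ^ (2 * n - 1) +
        5 * ∑ j ∈ Finset.Icc 1 (n / 5), (Nat.choose (2 * n) (n + 5 * j) : ℤ) := by
  have h := (five_mul_chooseSumMod_two_mul n).1
  rw [chooseSumMod_two_mul_self] at h
  have hpow : (4 : ℤ) ^ n = 2 * 2 ^ (2 * n - 1) := by
    rw [← pow_succ', Nat.sub_add_cancel (by omega), pow_mul]
    norm_num
  have hchoose : ((2 * n).choose n : ℤ) = 2 * (2 * n - 1).choose n := by
    obtain ⟨m, rfl⟩ := Nat.exists_eq_add_of_le' hn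
    rw [show 2 * (m + 1) - 1 = 2 * m + 1 by omega, show 2 * (m + 1) = 2 * m + 1 + 1 by ring,
      Nat.choose_succ_succ', Nat.choose_symm_half]
    push_cast
    ring
  linarith
end

section
/- For every natural number n, the Lucas number L_{2n+1} satisfies L_{2n+1} = 2^{2n} − 5·Σ_{j≥0} C(2n+1, n+5j+3), where the sum is over all j ≥ 0 with n+5j+3 ≤ 2n+1 (all further terms vanish). -/
/-- The sum of the binomial coefficients `C(m, k)` over all `k ≡ r` modulo `5`. -/
def chooseSumModFive (m r : ℕ) : ℤ :=
  ∑ k ∈ Finset.range (m + 1), if k % 5 = r % 5 then (m.choose k : ℤ) else 0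

theorem chooseSumModFive_add_five (m r : ℕ) :
    chooseSumModFive m (r + 5) = chooseSumModFive m r := by
  simp [chooseSumModFive]

theorem chooseSumModFive_succ_succ (m r : ℕ) :
    chooseSumModFive (m + 1) (r + 1) = chooseSumModFive m r + chooseSumModFive m (r + 1) := by
  have extend : chooseSumModFive m (r + 1) =
      ∑ k ∈ Finset.range (m + 2), if k % 5 = (r + 1) % 5 then (m.choose k : ℤ) else 0 := by
    rw [Finset.sum_range_succ]
    simp [chooseSumModFive]
  rw [extend, chooseSumModFive, chooseSumModFive, Finset.sum_range_succ',
    Finset.sum_range_succ' _ (m + 1), ← add_assoc, ← Finset.sum_add_distrib]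
  congr 1
  · refine Finset.sum_congr rfl fun k _ => ?_
    have h : (k + 1) % 5 = (r + 1) % 5 ↔ k % 5 = r % 5 := by omega
    simp only [h, Nat.choose_succ_succ']
    split_ifs <;> simp
  · simp

theorem chooseSumModFive_add_two (m r : ℕ) :
    chooseSumModFive (m + 2) (r + 2) =
      chooseSumModFive m r + 2 * chooseSumModFive m (r + 1) + chooseSumModFive m (r + 2) := by
  rw [chooseSumModFive_succ_succ (m + 1) (r + 1), chooseSumModFive_succ_succ m r,
    chooseSumModFive_succ_succ m (r + 1)]
  ring

theorem five_mul_chooseSumModFive_odd (n : ℕ) :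
    5 * chooseSumModFive (2 * n + 1) n = 2 ^ (2 * n + 1) + lucas (2 * n + 2) ∧
    5 * chooseSumModFive (2 * n + 1) (n + 1) = 2 ^ (2 * n + 1) + lucas (2 * n + 2) ∧
    5 * chooseSumModFive (2 * n + 1) (n + 2) = 2 ^ (2 * n + 1) - lucas (2 * n) ∧
    5 * chooseSumModFive (2 * n + 1) (n + 3) = 2 ^ (2 * n + 1) - 2 * lucas (2 * n + 1) ∧
    5 * chooseSumModFive (2 * n + 1) (n + 4) = 2 ^ (2 * n + 1) - lucas (2 * n) := by
  induction n with
  | zero => simp [chooseSumModFive, Finset.sum_range_succ, lucas]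
  | succ n ih =>
    obtain ⟨h0, h1, h2, h3, h4⟩ := ih
    have s0 := chooseSumModFive_add_two (2 * n + 1) n
    have s1 := chooseSumModFive_add_two (2 * n + 1) (n + 1)
    have s2 := chooseSumModFive_add_two (2 * n + 1) (n + 2)
    have s3 := chooseSumModFive_add_two (2 * n + 1) (n + 3)
    have s4 := chooseSumModFive_add_two (2 * n + 1) (n + 4)
    have p0 := chooseSumModFive_add_five (2 * n + 1) n
    have p1 := chooseSumModFive_add_five (2 * n + 1) (n + 1)
    have q1 := chooseSumModFive_add_five (2 * n + 1 + 2) (n + 1)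
    have l2 : (lucas (2 * n + 2) : ℤ) = lucas (2 * n + 1) + lucas (2 * n) := by
      simp [lucas]
    have l3 : (lucas (2 * n + 3) : ℤ) = lucas (2 * n + 2) + lucas (2 * n + 1) := by
      simp [lucas]
    have l4 : (lucas (2 * n + 4) : ℤ) = lucas (2 * n + 3) + lucas (2 * n + 2) := by
      simp [lucas]
    have hp : (2 : ℤ) ^ (2 * n + 3) = 4 * 2 ^ (2 * n + 1) := by ring
    simp only [add_assoc, mul_add, Nat.reduceAdd, mul_one] at *
    refine ⟨?_, ?_, ?_, ?_, ?_⟩ <;> linarith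

theorem chooseSumModFive_odd_eq_two_mul (n : ℕ) :
    chooseSumModFive (2 * n + 1) (n + 3) =
      2 * ∑ j ∈ (Finset.range (n + 1)).filter (fun j => n + 5 * j + 3 ≤ 2 * n + 1),
            (Nat.choose (2 * n + 1) (n + 5 * j + 3) : ℤ) := by
  have upper : ∑ i ∈ Finset.range (n + 1),
      (if (n + 1 + i) % 5 = (n + 3) % 5 then ((2 * n + 1).choose (n + 1 + i) : ℤ) else 0) =
      ∑ j ∈ (Finset.range (n + 1)).filter (fun j => n + 5 * j + 3 ≤ 2 * n + 1),
        (Nat.choose (2 * n + 1) (n + 5 * j + 3) : ℤ) := by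
    rw [← Finset.sum_filter]
    refine Finset.sum_nbij' (fun i => (i - 2) / 5) (fun j => 5 * j + 2) ?_ ?_ ?_ ?_ ?_ <;>
      simp only [Finset.mem_filter, Finset.mem_range]
    · intro i hi; omega
    · intro j hj; omega
    · intro i hi; omega
    · intro j hj; omega
    · intro i hi
      congr 2
      omega
  have lower : ∑ i ∈ Finset.range (n + 1),
      (if i % 5 = (n + 3) % 5 then ((2 * n + 1).choose i : ℤ) else 0) =
      ∑ i ∈ Finset.range (n + 1),
      (if (n + 1 + i) % 5 = (n + 3) % 5 then ((2 * n + 1).choose (n + 1 + i) : ℤ) else 0) := by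
    rw [← Finset.sum_range_reflect]
    refine Finset.sum_congr rfl fun i hi => ?_
    rw [Finset.mem_range] at hi
    have h : (n + 1 - 1 - i) % 5 = (n + 3) % 5 ↔ (n + 1 + i) % 5 = (n + 3) % 5 := by omega
    have hc : (2 * n + 1).choose (n + 1 - 1 - i) = (2 * n + 1).choose (n + 1 + i) :=
      Nat.choose_symm_of_eq_add (by omega)
    simp only [h, hc]
  rw [chooseSumModFive, show 2 * n + 1 + 1 = (n + 1) + (n + 1) by ring, Finset.sum_range_add,
    lower, upper]
  exact (two_mul _).symm

theorem lucas_odd_eq (n : ℕ) :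
    (lucas (2 * n + 1) : ℤ) =
      2 ^ (2 * n) -
        5 * ∑ j ∈ (Finset.range (n + 1)).filter (fun j => n + 5 * j + 3 ≤ 2 * n + 1),
              (Nat.choose (2 * n + 1) (n + 5 * j + 3) : ℤ) := by
  have h := (five_mul_chooseSumModFive_odd n).2.2.2.1
  rw [chooseSumModFive_odd_eq_two_mul, pow_succ] at h
  linarith
end

section
/- For every natural number n ≥ 1, if A_{2n} = Σ_{1≤k≤n, k ≡ 1 or 4 (mod 5)} C(2n, n+k), then 5·A_{2n} = 2^{2n} + L_{2n−1}. -/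
/-- The sum of `C(2n, n + k) f(k)` over all integers `-n ≤ k ≤ n`. -/
def centralSum (n : ℕ) (f : ℤ → ℤ) : ℤ :=
  ∑ j ∈ Finset.range (2 * n + 1), ((2 * n).choose j : ℤ) * f ((j : ℤ) - n)

lemma sum_choose_succ_mul_eq (m : ℕ) (f : ℕ → ℤ) :
    ∑ j ∈ Finset.range (m + 2), ((m + 1).choose j : ℤ) * f j =
      ∑ j ∈ Finset.range (m + 1), (m.choose j : ℤ) * (f j + f (j + 1)) := by
  rw [Finset.sum_choose_succ_mul (fun i _ => f i) m, ← Finset.sum_add_distrib]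
  exact Finset.sum_congr rfl fun _ _ => by ring

lemma centralSum_succ (n : ℕ) (f : ℤ → ℤ) :
    centralSum (n + 1) f = centralSum n (fun k => f (k - 1) + 2 * f k + f (k + 1)) := by
  unfold centralSum
  rw [show 2 * (n + 1) = 2 * n + 1 + 1 by ring,
    sum_choose_succ_mul_eq (2 * n + 1) (fun j => f ((j : ℤ) - (n + 1 : ℕ))),
    sum_choose_succ_mul_eq (2 * n)
      (fun j => f ((j : ℤ) - (n + 1 : ℕ)) + f (((j + 1 : ℕ) : ℤ) - (n + 1 : ℕ)))]
  refine Finset.sum_congr rfl fun j _ => ?_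
  push_cast
  rw [show (j : ℤ) + 1 - (n + 1) = j - n by ring, show (j : ℤ) - (n + 1) = j - n - 1 by ring,
    show (j : ℤ) + 1 + 1 - (n + 1) = j - n + 1 by ring]
  ring

lemma centralSum_add (n : ℕ) (f g : ℤ → ℤ) :
    centralSum n (fun k => f k + g k) = centralSum n f + centralSum n g := by
  simp only [centralSum, mul_add, Finset.sum_add_distrib]

lemma centralSum_const_mul (n : ℕ) (c : ℤ) (f : ℤ → ℤ) :
    centralSum n (fun k => c * f k) = c * centralSum n f := by
  simp only [centralSum, Finset.mul_sum]
  exact Finset.sum_congr rfl fun _ _ => by ring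

lemma centralSum_of_even (n : ℕ) (f : ℤ → ℤ) (hf : ∀ k, f (-k) = f k) :
    centralSum n f = ((2 * n).choose n : ℤ) * f 0 +
      2 * ∑ k ∈ Finset.Icc 1 n, ((2 * n).choose (n + k) : ℤ) * f k := by
  have hIcc : ∑ k ∈ Finset.Icc 1 n, ((2 * n).choose (n + k) : ℤ) * f k =
      ∑ i ∈ Finset.range n, ((2 * n).choose (n + (i + 1)) : ℤ) * f ((i + 1 : ℕ) : ℤ) := by
    rw [Finset.range_eq_Ico, Finset.sum_Ico_add' (fun k : ℕ =>
      ((2 * n).choose (n + k) : ℤ) * f k) 0 n 1]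
    rfl
  have hlow : ∑ j ∈ Finset.range n, ((2 * n).choose j : ℤ) * f ((j : ℤ) - n) =
      ∑ i ∈ Finset.range n, ((2 * n).choose (n + (i + 1)) : ℤ) * f ((i + 1 : ℕ) : ℤ) := by
    rw [← Finset.sum_range_reflect]
    refine Finset.sum_congr rfl fun i hi => ?_
    have hi' := Finset.mem_range.mp hi
    rw [← Nat.choose_symm_of_eq_add (show 2 * n = (n + (i + 1)) + (n - 1 - i) by omega), ← hf]
    congr 2
    omega
  unfold centralSum
  rw [show 2 * n + 1 = n + (n + 1) by ring, Finset.sum_range_add, Finset.sum_range_succ', hlow,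
    hIcc]
  simp only [Nat.cast_add, add_sub_cancel_left, add_zero, sub_self]
  ring

/-- The indicator function of the integers congruent to `r` or `-r` modulo `5`. -/
def residueIndicator (r k : ℤ) : ℤ := if k % 5 = r % 5 ∨ k % 5 = (-r) % 5 then 1 else 0

lemma residueIndicator_neg (r k : ℤ) : residueIndicator r (-k) = residueIndicator r k := by
  unfold residueIndicator
  congr 1
  apply propext
  omega

lemma centralSum_succ_residueIndicator_zero (n : ℕ) :
    centralSum (n + 1) (residueIndicator 0) =
      2 * centralSum n (residueIndicator 0) + centralSum n (residueIndicator 1) := by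
  rw [centralSum_succ, ← centralSum_const_mul, ← centralSum_add]
  congr 1
  funext k
  unfold residueIndicator
  split_ifs <;> omega

lemma centralSum_succ_residueIndicator_one (n : ℕ) :
    centralSum (n + 1) (residueIndicator 1) =
      2 * centralSum n (residueIndicator 0) + 2 * centralSum n (residueIndicator 1) +
        centralSum n (residueIndicator 2) := by
  rw [centralSum_succ, ← centralSum_const_mul, ← centralSum_const_mul, ← centralSum_add,
    ← centralSum_add]
  congr 1
  funext k
  unfold residueIndicator
  split_ifs <;> omega

lemma centralSum_succ_residueIndicator_two (n : ℕ) :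
    centralSum (n + 1) (residueIndicator 2) =
      centralSum n (residueIndicator 1) + 3 * centralSum n (residueIndicator 2) := by
  rw [centralSum_succ, ← centralSum_const_mul, ← centralSum_add]
  congr 1
  funext k
  unfold residueIndicator
  split_ifs <;> omega

lemma five_mul_centralSum_residueIndicator (n : ℕ) :
    5 * centralSum n (residueIndicator 0) = 2 ^ (2 * n) + 2 * lucas (2 * n) ∧
    5 * centralSum n (residueIndicator 1) =
      2 * 2 ^ (2 * n) + 2 * (lucas (2 * n + 1) - lucas (2 * n)) ∧
    5 * centralSum n (residueIndicator 2) = 2 * 2 ^ (2 * n) - 2 * lucas (2 * n + 1) := by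
  induction n with
  | zero => simp [centralSum, residueIndicator, lucas]
  | succ n ih =>
    obtain ⟨h0, h1, h2⟩ := ih
    have hL2 : lucas (2 * (n + 1)) = lucas (2 * n + 1) + lucas (2 * n) := rfl
    have hL3 : lucas (2 * (n + 1) + 1) = lucas (2 * (n + 1)) + lucas (2 * n + 1) := rfl
    rw [centralSum_succ_residueIndicator_zero, centralSum_succ_residueIndicator_one,
      centralSum_succ_residueIndicator_two, hL3, hL2, show 2 * (n + 1) = 2 * n + 2 by ring,
      pow_add]
    push_cast
    refine ⟨?_, ?_, ?_⟩ <;> linarith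

theorem five_mul_A_eq (n : ℕ) (hn : 1 ≤ n)
    (A : ℕ)
    (hA : A = ∑ k ∈ (Finset.Icc 1 n).filter (fun k => k % 5 = 1 ∨ k % 5 = 4),
                Nat.choose (2 * n) (n + k)) :
    5 * A = 2 ^ (2 * n) + lucas (2 * n - 1) := by
  obtain ⟨m, rfl⟩ : ∃ m, n = m + 1 := ⟨n - 1, by omega⟩
  have hA2 : centralSum (m + 1) (residueIndicator 1) = 2 * A := by
    rw [centralSum_of_even _ _ (residueIndicator_neg 1), hA, Finset.sum_filter]
    push_cast
    rw [show residueIndicator 1 0 = 0 from rfl, mul_zero, zero_add]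
    congr 1
    refine Finset.sum_congr rfl fun k _ => ?_
    unfold residueIndicator
    split_ifs <;> omega
  have h := (five_mul_centralSum_residueIndicator (m + 1)).2.1
  have hL : lucas (2 * (m + 1) + 1) = lucas (2 * (m + 1)) + lucas (2 * (m + 1) - 1) := rfl
  rw [hA2, hL] at h
  zify
  push_cast at h
  linarith
end

section
/- For every natural number n, if B_{2n} = Σ_{1≤k≤n, k ≡ 2 or 3 (mod 5)} C(2n, n+k), then 5·B_{2n} = 2^{2n} − L_{2n+1}. -/
/-- The sum of the binomial coefficients `C(m, j)` over those `j` in the residue class `r`. -/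
def residueChooseSum (d m : ℕ) (r : ZMod d) : ℕ :=
  ∑ j ∈ Finset.range (m + 1), if (j : ZMod d) = r then m.choose j else 0

theorem residueChooseSum_succ (d m : ℕ) (r : ZMod d) :
    residueChooseSum d (m + 1) r = residueChooseSum d m r + residueChooseSum d m (r - 1) := by
  have h : residueChooseSum d m r =
      ∑ j ∈ Finset.range (m + 2), if (j : ZMod d) = r then m.choose j else 0 := by
    rw [Finset.sum_range_succ]
    simp [residueChooseSum]
  rw [h, Finset.sum_range_succ', residueChooseSum, Finset.sum_range_succ', residueChooseSum,
    add_right_comm, ← Finset.sum_add_distrib]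
  congr 1
  · refine Finset.sum_congr rfl fun j _ => ?_
    simp only [Nat.cast_add, Nat.cast_one, eq_sub_iff_add_eq, Nat.choose_succ_succ']
    split_ifs <;> ring
  · simp

theorem residueChooseSum_two_mul_succ (d n : ℕ) (r : ZMod d) :
    residueChooseSum d (2 * (n + 1)) ((n + 1 : ℕ) + r) =
      residueChooseSum d (2 * n) (n + (r + 1)) + 2 * residueChooseSum d (2 * n) (n + r) +
        residueChooseSum d (2 * n) (n + (r - 1)) := by
  have h₁ : ((n + 1 : ℕ) : ZMod d) + r = n + (r + 1) := by push_cast; ring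
  have h₂ : (n : ZMod d) + (r + 1) - 1 = n + r := by ring
  have h₃ : (n : ZMod d) + r - 1 = n + (r - 1) := by ring
  rw [show 2 * (n + 1) = 2 * n + 1 + 1 by ring, h₁]
  simp only [residueChooseSum_succ, h₂, h₃]
  ring

theorem five_mul_residueChooseSum (n : ℕ) :
    5 * (residueChooseSum 5 (2 * n) (n + 0) : ℤ) = 2 ^ (2 * n) + 2 * lucas (2 * n) ∧
    5 * (residueChooseSum 5 (2 * n) (n + 1) : ℤ) =
      2 ^ (2 * n) + lucas (2 * n + 1) - lucas (2 * n) ∧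
    5 * (residueChooseSum 5 (2 * n) (n + 2) : ℤ) = 2 ^ (2 * n) - lucas (2 * n + 1) ∧
    5 * (residueChooseSum 5 (2 * n) (n + 3) : ℤ) = 2 ^ (2 * n) - lucas (2 * n + 1) ∧
    5 * (residueChooseSum 5 (2 * n) (n + 4) : ℤ) =
      2 ^ (2 * n) + lucas (2 * n + 1) - lucas (2 * n) := by
  induction n with
  | zero => decide
  | succ n ih =>
    obtain ⟨h₀, h₁, h₂, h₃, h₄⟩ := ih
    have e₁ : lucas (2 * (n + 1)) = lucas (2 * n + 1) + lucas (2 * n) := rfl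
    have e₂ : lucas (2 * (n + 1) + 1) = lucas (2 * (n + 1)) + lucas (2 * n + 1) := rfl
    have e₃ : (2 : ℤ) ^ (2 * (n + 1)) = 4 * 2 ^ (2 * n) := by ring
    simp only [residueChooseSum_two_mul_succ, e₂, e₁, e₃,
      show (0 + 1 : ZMod 5) = 1 by decide, show (0 - 1 : ZMod 5) = 4 by decide,
      show (1 + 1 : ZMod 5) = 2 by decide, show (1 - 1 : ZMod 5) = 0 by decide,
      show (2 + 1 : ZMod 5) = 3 by decide, show (2 - 1 : ZMod 5) = 1 by decide,
      show (3 + 1 : ZMod 5) = 4 by decide, show (3 - 1 : ZMod 5) = 2 by decide,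
      show (4 + 1 : ZMod 5) = 0 by decide, show (4 - 1 : ZMod 5) = 3 by decide]
    push_cast
    refine ⟨?_, ?_, ?_, ?_, ?_⟩ <;> linarith

theorem sum_choose_eq_residueChooseSum (n : ℕ) :
    ∑ k ∈ (Finset.Icc 1 n).filter (fun k => k % 5 = 2 ∨ k % 5 = 3), (2 * n).choose (n + k) =
      residueChooseSum 5 (2 * n) (n + 2) := by
  have hcond (j : ℕ) : ((j : ZMod 5) = n + 2) ↔ j % 5 = (n + 2) % 5 := by
    rw [← Nat.cast_ofNat (n := 2), ← Nat.cast_add, ZMod.natCast_eq_natCast_iff']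
  rw [Finset.sum_filter, ← Finset.Ico_add_one_right_eq_Icc, Finset.sum_Ico_eq_sum_range,
    residueChooseSum, show 2 * n + 1 = n + (n + 1) by ring, Finset.sum_range_add,
    Finset.sum_range_succ',
    ← Finset.sum_range_reflect (fun j => if (j : ZMod 5) = n + 2 then (2 * n).choose j else 0)]
  simp only [hcond, Nat.add_sub_cancel]
  rw [if_neg (by omega), add_zero, ← Finset.sum_add_distrib]
  refine Finset.sum_congr rfl fun i hi => ?_
  have hi' := Finset.mem_range.mp hi
  have hsymm : (2 * n).choose (n - 1 - i) = (2 * n).choose (n + (1 + i)) :=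
    Nat.choose_symm_of_eq_add (by omega)
  rw [hsymm, add_comm i 1]
  split_ifs <;> omega

theorem five_mul_B_eq (n : ℕ)
    (B : ℕ)
    (hB : B = ∑ k ∈ (Finset.Icc 1 n).filter (fun k => k % 5 = 2 ∨ k % 5 = 3),
                Nat.choose (2 * n) (n + k)) :
    5 * (B : ℤ) = 2 ^ (2 * n) - lucas (2 * n + 1) := by
  rw [hB, sum_choose_eq_residueChooseSum]
  exact (five_mul_residueChooseSum n).2.2.1
end

section
/- For every natural number n ≥ 1, 3^{n−1} = C(2n−1, n) + Σ_{j=1}^{⌊n/3⌋} (−1)^j · C(2n, n+3j). -/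
/-- Pascal's rule for weighted sums along a row of Pascal's triangle. -/
theorem sum_range_choose_succ_mul (n : ℕ) (f : ℕ → ℤ) :
    ∑ k ∈ Finset.range (n + 2), ((n + 1).choose k : ℤ) * f k =
      ∑ k ∈ Finset.range (n + 1), (n.choose k : ℤ) * (f k + f (k + 1)) := by
  have h := Finset.sum_choose_succ_mul (fun i _ => f i) n
  rw [h, ← Finset.sum_add_distrib]
  exact Finset.sum_congr rfl fun k _ => by ring

/-- The sum of `f` over the `2 * n`-th row of Pascal's triangle, indexed from its centre. -/
def centralChooseSum (f : ℤ → ℤ) (n : ℕ) : ℤ :=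
  ∑ k ∈ Finset.range (2 * n + 1), ((2 * n).choose k : ℤ) * f (k - n)

theorem centralChooseSum_succ (f : ℤ → ℤ) (n : ℕ) :
    centralChooseSum f (n + 1) =
      centralChooseSum (fun m => f (m - 1) + 2 * f m + f (m + 1)) n := by
  unfold centralChooseSum
  rw [show 2 * (n + 1) = 2 * n + 1 + 1 by ring,
    sum_range_choose_succ_mul (2 * n + 1) (fun k => f (k - (n + 1 : ℕ))),
    sum_range_choose_succ_mul (2 * n)]
  refine Finset.sum_congr rfl fun k _ => ?_
  push_cast
  rw [show (k : ℤ) - (n + 1) = k - n - 1 by ring, show (k : ℤ) + 1 - (n + 1) = k - n by ring,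
    show (k : ℤ) + 1 + 1 - (n + 1) = k - n + 1 by ring]
  ring

theorem centralChooseSum_of_even (f : ℤ → ℤ) (hf : ∀ m, f (-m) = f m) (n : ℕ) :
    centralChooseSum f n = (2 * n).choose n * f 0 +
      2 * ∑ i ∈ Finset.range n, ((2 * n).choose (n + (i + 1)) : ℤ) * f (i + 1) := by
  unfold centralChooseSum
  rw [show 2 * n + 1 = n + (n + 1) by ring, Finset.sum_range_add, Finset.sum_range_succ',
    ← Finset.sum_range_reflect]
  have h : ∑ j ∈ Finset.range n,
      ((2 * n).choose (n - 1 - j) : ℤ) * f ((n - 1 - j : ℕ) - n) =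
      ∑ i ∈ Finset.range n, ((2 * n).choose (n + (i + 1)) : ℤ) * f (i + 1) := by
    refine Finset.sum_congr rfl fun j hj => ?_
    have hj := Finset.mem_range.1 hj
    rw [Nat.choose_symm_of_eq_add (show 2 * n = n - 1 - j + (n + (j + 1)) by omega),
      show ((n - 1 - j : ℕ) : ℤ) - n = -(j + 1) by omega, hf]
  rw [h]
  simp
  ring

/-- The even function on `ℤ` sending `3 * j` to `(-1) ^ j` and vanishing off multiples of `3`. -/
def altThree (m : ℤ) : ℤ := if m % 6 = 0 then 1 else if m % 6 = 3 then -1 else 0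

theorem altThree_neg (m : ℤ) : altThree (-m) = altThree m := by
  unfold altThree
  split_ifs <;> omega

theorem altThree_three_mul (j : ℕ) : altThree (3 * j) = (-1) ^ j := by
  unfold altThree
  rcases Nat.even_or_odd j with h | h
  · rw [h.neg_one_pow, if_pos]
    obtain ⟨r, rfl⟩ := h
    omega
  · rw [h.neg_one_pow, if_neg, if_pos] <;> obtain ⟨r, rfl⟩ := h <;> omega

theorem altThree_of_not_dvd {m : ℤ} (h : ¬ 3 ∣ m) : altThree m = 0 := by
  unfold altThree
  split_ifs <;> omega

/-- The function `m ↦ 2 * cos (π * m / 3)`, obtained from `altThree` by a binomial smoothing. -/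
def smoothedAltThree (m : ℤ) : ℤ := altThree (m - 1) + 2 * altThree m + altThree (m + 1)

theorem smoothedAltThree_smoothing (m : ℤ) :
    smoothedAltThree (m - 1) + 2 * smoothedAltThree m + smoothedAltThree (m + 1) =
      3 * smoothedAltThree m := by
  have h : altThree (m - 1 - 1) = -altThree (m + 1) := by
    unfold altThree
    split_ifs <;> omega
  have h' : altThree (m + 1 + 1) = -altThree (m - 1) := by
    unfold altThree
    split_ifs <;> omega
  simp only [smoothedAltThree, sub_add_cancel, add_sub_cancel_right, h, h']
  ring

theorem centralChooseSum_smoothedAltThree (n : ℕ) :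
    centralChooseSum smoothedAltThree n = 2 * 3 ^ n := by
  induction n with
  | zero => decide
  | succ n ih =>
    rw [centralChooseSum_succ, funext smoothedAltThree_smoothing, pow_succ, ← mul_assoc, ← ih]
    simp only [centralChooseSum, Finset.sum_mul]
    exact Finset.sum_congr rfl fun k _ => by ring

theorem three_pow_eq_choose_sum (n : ℕ) (hn : 1 ≤ n) :
    (3 : ℤ) ^ (n - 1) =
      Nat.choose (2 * n - 1) n +
        ∑ j ∈ Finset.Icc 1 (n / 3), (-1 : ℤ) ^ j * Nat.choose (2 * n) (n + 3 * j) := by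
  have hsum : ∑ j ∈ Finset.Icc 1 (n / 3), (-1 : ℤ) ^ j * Nat.choose (2 * n) (n + 3 * j) =
      ∑ i ∈ Finset.range n, ((2 * n).choose (n + (i + 1)) : ℤ) * altThree (i + 1) := by
    refine Finset.sum_of_injOn (fun j => 3 * j - 1) ?_ ?_ ?_ ?_
    · intro a ha b hb hab
      simp only [Finset.coe_Icc, Set.mem_Icc] at ha hb hab
      omega
    · intro a ha
      simp only [Finset.coe_Icc, Set.mem_Icc, Finset.coe_range, Set.mem_Iio] at ha ⊢
      omega
    · intro i hi hi'
      rw [altThree_of_not_dvd, mul_zero]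
      intro hdvd
      have hi := Finset.mem_range.1 hi
      refine hi' ⟨(i + 1) / 3, ?_, ?_⟩
      · simp only [Finset.coe_Icc, Set.mem_Icc]
        omega
      · dsimp only
        omega
    · intro j hj
      have hj := (Finset.mem_Icc.1 hj).1
      rw [← altThree_three_mul, show 3 * j - 1 + 1 = 3 * j by omega,
        show ((3 * j - 1 : ℕ) : ℤ) + 1 = 3 * j by omega, mul_comm]
  obtain ⟨n, rfl⟩ := Nat.exists_eq_add_of_le' hn
  have hcentral : ((2 * (n + 1)).choose (n + 1) : ℤ) =
      2 * ((2 * (n + 1) - 1).choose (n + 1) : ℤ) := by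
    rw [show 2 * (n + 1) - 1 = 2 * n + 1 by omega, show 2 * (n + 1) = 2 * n + 1 + 1 by ring,
      Nat.choose_succ_succ,
      Nat.choose_symm_of_eq_add (show 2 * n + 1 = n + (n + 1) by ring)]
    push_cast
    ring
  have heven := centralChooseSum_of_even altThree altThree_neg (n + 1)
  have hpow : centralChooseSum altThree (n + 1) = 2 * 3 ^ n :=
    (centralChooseSum_succ altThree n).trans (centralChooseSum_smoothedAltThree n)
  rw [hpow, hcentral, ← hsum, show altThree 0 = 1 from rfl] at heven
  rw [Nat.add_sub_cancel]
  linarith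
end

section
/- For every natural number n, the real number W_{2n} = (2·cos(2π/7))^{2n} + (2·cos(4π/7))^{2n} + (2·cos(8π/7))^{2n} satisfies W_{2n} = (7/2)·C(2n, n) − 2^{2n−1} + 7·Σ_{j=1}^{⌊n/7⌋} C(2n, n+7j). -/
open Real

theorem sum_range_ite_dvd_succ {M : Type*} [AddCommMonoid M] (N : ℕ) (g : ℕ → M) (n : ℕ) :
    ∑ i ∈ Finset.range n, (if N ∣ i + 1 then g (i + 1) else 0) =
      ∑ j ∈ Finset.Icc 1 (n / N), g (N * j) := by
  induction n with
  | zero => simp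
  | succ n ih =>
    rw [Finset.sum_range_succ, ih, Nat.succ_div]
    split_ifs with h
    · rw [Finset.sum_Icc_succ_top (Nat.le_add_left 1 _)]
      congr 2
      have := Nat.mul_div_cancel' h
      rwa [Nat.succ_div_of_dvd h, eq_comm] at this
    · simp

theorem sum_choose_ite_dvd_sub (N n : ℕ) :
    ∑ m ∈ Finset.range (2 * n + 1),
        (if (N : ℤ) ∣ (m : ℤ) - n then ((2 * n).choose m : ℝ) else 0) =
      (2 * n).choose n + 2 * ∑ j ∈ Finset.Icc 1 (n / N), ((2 * n).choose (n + N * j) : ℝ) := by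
  have hupper : ∑ i ∈ Finset.range n, (if (N : ℤ) ∣ ((n + 1 + i : ℕ) : ℤ) - n then
      ((2 * n).choose (n + 1 + i) : ℝ) else 0) =
      ∑ j ∈ Finset.Icc 1 (n / N), ((2 * n).choose (n + N * j) : ℝ) := by
    rw [← sum_range_ite_dvd_succ N fun i => ((2 * n).choose (n + i) : ℝ)]
    refine Finset.sum_congr rfl fun i _ => ?_
    have h : ((n + (i + 1) : ℕ) : ℤ) - n = (i + 1 : ℕ) := by push_cast; ring
    simp only [add_assoc, add_comm 1 i, h, Int.natCast_dvd_natCast]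
  have hlower : ∑ m ∈ Finset.range n, (if (N : ℤ) ∣ (m : ℤ) - n then
      ((2 * n).choose m : ℝ) else 0) =
      ∑ j ∈ Finset.Icc 1 (n / N), ((2 * n).choose (n + N * j) : ℝ) := by
    rw [← hupper, ← Finset.sum_range_reflect]
    refine Finset.sum_congr rfl fun i hi => ?_
    rw [Finset.mem_range] at hi
    have h : ((n - 1 - i : ℕ) : ℤ) - n = -(((n + 1 + i : ℕ) : ℤ) - n) := by omega
    simp only [h, dvd_neg,
      Nat.choose_symm_of_eq_add (by omega : 2 * n = (n - 1 - i) + (n + 1 + i))]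
  rw [show 2 * n + 1 = n + 1 + n by ring, Finset.sum_range_add, Finset.sum_range_succ, hupper,
    hlower]
  simp only [sub_self, dvd_zero, if_true]
  ring

theorem IsPrimitiveRoot.sum_zpow_pow {K : Type*} [Field K] {ζ : K} {N : ℕ}
    (hζ : IsPrimitiveRoot ζ N) (j : ℤ) :
    ∑ k ∈ Finset.range N, (ζ ^ j) ^ k = if (N : ℤ) ∣ j then (N : K) else 0 := by
  split_ifs with h
  · simp [(hζ.zpow_eq_one_iff_dvd j).2 h]
  · have hne : ζ ^ j ≠ 1 := fun h1 => h ((hζ.zpow_eq_one_iff_dvd j).1 h1)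
    rw [geom_sum_eq hne, ← zpow_natCast, zpow_comm, zpow_natCast, hζ.pow_eq_one, one_zpow,
      sub_self, zero_div]

theorem sum_two_mul_cos_pow {N : ℕ} (hN : N ≠ 0) (n : ℕ) :
    ∑ k ∈ Finset.range N, (2 * Real.cos (k * π / N)) ^ (2 * n) =
      N * ∑ m ∈ Finset.range (2 * n + 1),
        (if (N : ℤ) ∣ (m : ℤ) - n then ((2 * n).choose m : ℝ) else 0) := by
  have hζ := Complex.isPrimitiveRoot_exp N hN
  have hterm (k : ℕ) : ((2 * Real.cos (k * π / N) : ℝ) : ℂ) ^ (2 * n) =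
      ∑ m ∈ Finset.range (2 * n + 1),
        (Complex.exp (2 * π * Complex.I / N) ^ ((m : ℤ) - n)) ^ k * ((2 * n).choose m : ℂ) := by
    push_cast
    rw [Complex.two_cos, add_pow]
    refine Finset.sum_congr rfl fun m hm => ?_
    rw [Finset.mem_range] at hm
    congr 1
    rw [← Complex.exp_nat_mul, ← Complex.exp_nat_mul, ← Complex.exp_add, ← Complex.exp_int_mul,
      ← Complex.exp_nat_mul, Nat.cast_sub (by omega)]
    congr 1
    push_cast
    ring
  apply Complex.ofReal_injective
  rw [Complex.ofReal_sum]
  simp_rw [Complex.ofReal_pow, hterm]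
  rw [Finset.sum_comm]
  simp_rw [← Finset.sum_mul, hζ.sum_zpow_pow]
  push_cast
  rw [Finset.mul_sum]
  refine Finset.sum_congr rfl fun m _ => ?_
  split_ifs <;> simp

theorem W_even_eq (n : ℕ) :
    (2 * Real.cos (2 * π / 7)) ^ (2 * n) + (2 * Real.cos (4 * π / 7)) ^ (2 * n) +
        (2 * Real.cos (8 * π / 7)) ^ (2 * n) =
      (7 / 2) * Nat.choose (2 * n) n - (2 : ℝ) ^ (2 * (n : ℤ) - 1) +
        7 * ∑ j ∈ Finset.Icc 1 (n / 7), (Nat.choose (2 * n) (n + 7 * j) : ℝ) := by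
  have h := sum_two_mul_cos_pow (N := 7) (by norm_num) n
  rw [sum_choose_ite_dvd_sub] at h
  have hpow : (2 : ℝ) ^ (2 * (n : ℤ) - 1) = 2 ^ (2 * n) / 2 := by
    rw [zpow_sub_one₀ two_ne_zero, div_eq_mul_inv]
    norm_cast
  have hreflect (x y : ℝ) (hxy : x = π - y) :
      (2 * Real.cos x) ^ (2 * n) = (2 * Real.cos y) ^ (2 * n) := by
    rw [hxy, Real.cos_pi_sub, mul_neg, (even_two_mul n).neg_pow]
  have h8 : (2 * Real.cos (8 * π / 7)) ^ (2 * n) = (2 * Real.cos (1 * π / 7)) ^ (2 * n) := by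
    rw [← Real.cos_neg (1 * π / 7)]
    exact hreflect _ _ (by ring)
  simp only [Finset.sum_range_succ, Finset.sum_range_zero, Nat.cast_zero, Nat.cast_one,
    Nat.cast_ofNat, zero_mul, zero_div, Real.cos_zero, mul_one, zero_add] at h
  rw [hreflect (3 * π / 7) (4 * π / 7) (by ring), hreflect (5 * π / 7) (2 * π / 7) (by ring),
    hreflect (6 * π / 7) (1 * π / 7) (by ring)] at h
  rw [hpow, h8]
  linarith
end

section
/- For every natural number n, the real number W_{2n+1} = (2·cos(2π/7))^{2n+1} + (2·cos(4π/7))^{2n+1} + (2·cos(8π/7))^{2n+1} satisfies W_{2n+1} = 7·Σ_{j≥0} C(2n+1, n+7j+4) − 2^{2n}, where the sum is over all j ≥ 0 with n+7j+4 ≤ 2n+1 (all further terms vanish). -/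
open Real

/-- Expansion of a power of `2 cos θ` in cosines of multiples of `θ`. -/
lemma two_mul_cos_pow (m : ℕ) (θ : ℝ) :
    (2 * cos θ) ^ m = ∑ i ∈ Finset.range (m + 1), (m.choose i : ℝ) * cos ((2 * i - m) * θ) := by
  have h : (((2 * cos θ) ^ m : ℝ) : ℂ) = ∑ i ∈ Finset.range (m + 1),
      ((m.choose i : ℝ) : ℂ) * Complex.exp (((2 * i - m) * θ : ℝ) * Complex.I) := by
    push_cast
    rw [Complex.two_cos, add_pow]
    refine Finset.sum_congr rfl fun i hi => ?_
    rw [← Complex.exp_nat_mul, ← Complex.exp_nat_mul, ← Complex.exp_add, mul_comm,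
      Nat.cast_sub (Nat.lt_succ_iff.mp (Finset.mem_range.mp hi))]
    congr 2
    ring
  have h' := congrArg Complex.re h
  rwa [Complex.ofReal_re, Complex.re_sum,
    Finset.sum_congr rfl fun i _ => by
      rw [Complex.re_ofReal_mul, Complex.exp_ofReal_mul_I_re]] at h'

lemma two_mul_cos_pow_odd (n : ℕ) (θ : ℝ) :
    (2 * cos θ) ^ (2 * n + 1) = 2 * ∑ k ∈ Finset.range (n + 1),
      ((2 * n + 1).choose (n + 1 + k) : ℝ) * cos ((2 * k + 1) * θ) := by
  rw [two_mul_cos_pow, show 2 * n + 1 + 1 = (n + 1) + (n + 1) by ring, Finset.sum_range_add,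
    ← Finset.sum_range_reflect, two_mul (Finset.sum _ _)]
  refine congrArg₂ (· + ·) (Finset.sum_congr rfl fun k hk => ?_)
    (Finset.sum_congr rfl fun k _ => ?_)
  · have hk' : k ≤ n := Nat.lt_succ_iff.mp (Finset.mem_range.mp hk)
    rw [Nat.add_sub_cancel, ← Nat.choose_symm (show n + 1 + k ≤ 2 * n + 1 by lia),
      show 2 * n + 1 - (n + 1 + k) = n - k by lia, Nat.cast_sub hk', ← cos_neg]
    congr 2
    push_cast
    ring
  · congr 2
    push_cast
    ring

lemma sum_choose_upper_half (n : ℕ) :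
    ∑ k ∈ Finset.range (n + 1), ((2 * n + 1).choose (n + 1 + k) : ℝ) = 2 ^ (2 * n) := by
  have h := two_mul_cos_pow_odd n 0
  simp only [mul_zero, cos_zero, mul_one, pow_succ] at h
  linarith

lemma cos_sum_sevenths (a : ℕ) :
    cos (a * (2 * π / 7)) + cos (a * (4 * π / 7)) + cos (a * (8 * π / 7)) =
      if 7 ∣ a then 3 else -1 / 2 := by
  split_ifs with h
  · obtain ⟨b, rfl⟩ := h
    have key (c : ℕ) : cos (((7 * b : ℕ) : ℝ) * (2 * c * π / 7)) = 1 := by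
      rw [← cos_nat_mul_two_pi (b * c)]
      congr 1
      push_cast
      ring
    have h1 := key 1
    have h2 := key 2
    have h4 := key 4
    norm_num at h1 h2 h4 ⊢
    rw [h1, h2, h4]
    norm_num
  · set x : ℝ := a * π / 7 with hx
    have hsin : sin x ≠ 0 := by
      intro h0
      obtain ⟨b, hb⟩ := sin_eq_zero_iff.mp h0
      have hab : (a : ℝ) = 7 * b := by
        rw [hx] at hb
        have := mul_right_cancel₀ pi_ne_zero (show (7 * b : ℝ) * π = a * π by linarith)
        exact this.symm
      have hab' : (a : ℤ) = 7 * b := by exact_mod_cast hab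
      lia
    have h8 : cos (a * (8 * π / 7)) = cos (6 * x) := by
      rw [← cos_nat_mul_two_pi_sub _ a]
      congr 1
      rw [hx]
      ring
    rw [h8, show a * (2 * π / 7) = 2 * x by rw [hx]; ring,
      show a * (4 * π / 7) = 4 * x by rw [hx]; ring]
    have h7 : sin (7 * x) = 0 := by
      rw [show 7 * x = a * π by rw [hx]; ring, sin_nat_mul_pi]
    have e1 := two_mul_sin_mul_cos x (2 * x)
    have e2 := two_mul_sin_mul_cos x (4 * x)
    have e3 := two_mul_sin_mul_cos x (6 * x)
    rw [show x - 2 * x = -x by ring, show x + 2 * x = 3 * x by ring, sin_neg] at e1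
    rw [show x - 4 * x = -(3 * x) by ring, show x + 4 * x = 5 * x by ring, sin_neg] at e2
    rw [show x - 6 * x = -(5 * x) by ring, show x + 6 * x = 7 * x by ring, sin_neg, h7] at e3
    apply mul_left_cancel₀ (mul_ne_zero two_ne_zero hsin)
    linarith

theorem W_odd_eq (n : ℕ) :
    (2 * Real.cos (2 * π / 7)) ^ (2 * n + 1) + (2 * Real.cos (4 * π / 7)) ^ (2 * n + 1) +
        (2 * Real.cos (8 * π / 7)) ^ (2 * n + 1) =
      7 * ∑ j ∈ (Finset.range (n + 1)).filter (fun j => n + 7 * j + 4 ≤ 2 * n + 1),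
            (Nat.choose (2 * n + 1) (n + 7 * j + 4) : ℝ) - (2 : ℝ) ^ (2 * n) := by
  have hreindex : ∑ j ∈ (Finset.range (n + 1)).filter (fun j => n + 7 * j + 4 ≤ 2 * n + 1),
      (Nat.choose (2 * n + 1) (n + 7 * j + 4) : ℝ) =
      ∑ k ∈ (Finset.range (n + 1)).filter (fun k => 7 ∣ 2 * k + 1),
        ((2 * n + 1).choose (n + 1 + k) : ℝ) := by
    refine Finset.sum_bij (fun j _ => 7 * j + 3) ?_ ?_ ?_ ?_
    · intro j hj
      simp only [Finset.mem_filter, Finset.mem_range] at hj ⊢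
      lia
    · intro i _ j _ h
      lia
    · intro k hk
      simp only [Finset.mem_filter, Finset.mem_range] at hk
      refine ⟨k / 7, ?_, by lia⟩
      simp only [Finset.mem_filter, Finset.mem_range]
      lia
    · intro j _
      rw [show n + 1 + (7 * j + 3) = n + 7 * j + 4 by ring]
  rw [hreindex, ← sum_choose_upper_half, Finset.sum_filter, two_mul_cos_pow_odd,
    two_mul_cos_pow_odd, two_mul_cos_pow_odd]
  simp only [Finset.mul_sum]
  rw [← Finset.sum_add_distrib, ← Finset.sum_add_distrib, ← Finset.sum_sub_distrib]
  refine Finset.sum_congr rfl fun k _ => ?_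
  have h := cos_sum_sevenths (2 * k + 1)
  push_cast at h
  rw [← mul_add, ← mul_add, ← mul_add, ← mul_add, h]
  split_ifs <;> ring
end

section
/- For every natural number m ≥ 1 and every natural number n, the real number L^{(m)}_{2n} = Σ_{t=0}^{m−1} (2·cos((2t+1)π/(2m+1)))^{2n} satisfies L^{(m)}_{2n} = ((2m+1)/2)·C(2n, n) − 2^{2n−1} + (2m+1)·Σ_{j≥1} C(2n, n+(2m+1)j), where the last sum is over all j ≥ 1 with (2m+1)j ≤ n (all further terms vanish). -/
open Real

/-- Binomial expansion of an even power of `2 cos θ` in powers of `exp (2 i θ)`. -/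
theorem two_mul_cos_pow_eq_sum (θ : ℂ) (n : ℕ) :
    (2 * Complex.cos θ) ^ (2 * n) =
      ∑ k ∈ Finset.range (2 * n + 1),
        ((2 * n).choose k : ℂ) * (Complex.exp (2 * θ * Complex.I)) ^ ((k : ℤ) - n) := by
  have h0 : Complex.exp (θ * Complex.I) ≠ 0 := Complex.exp_ne_zero _
  have h1 : 2 * Complex.cos θ =
      Complex.exp (θ * Complex.I) + (Complex.exp (θ * Complex.I))⁻¹ := by
    rw [Complex.two_cos, ← Complex.exp_neg, neg_mul]
  have h2 : Complex.exp (2 * θ * Complex.I) = Complex.exp (θ * Complex.I) ^ (2 : ℤ) := by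
    rw [← Complex.exp_int_mul]
    congr 1
    push_cast
    ring
  rw [h1, h2, add_pow]
  refine Finset.sum_congr rfl fun k hk => ?_
  have hk' : k ≤ 2 * n := by simpa [Nat.lt_succ_iff] using hk
  rw [mul_comm, ← zpow_mul, ← zpow_natCast, inv_pow, ← zpow_natCast, ← zpow_neg, ← zpow_add₀ h0]
  congr 2
  push_cast [Nat.cast_sub hk']
  ring

/-- Sum of the `d`-th powers of the odd powers of a primitive root of unity of odd order. -/
theorem IsPrimitiveRoot.sum_odd_pow_zpow {K : Type*} [Field K] {ζ : K} {N : ℕ}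
    (hζ : IsPrimitiveRoot ζ N) (hN : Odd N) (d : ℤ) :
    ∑ t ∈ Finset.range N, (ζ ^ (2 * t + 1)) ^ d = if (N : ℤ) ∣ d then (N : K) else 0 := by
  have h (t : ℕ) : (ζ ^ (2 * t + 1)) ^ d = ζ ^ d * ((ζ ^ d) ^ 2) ^ t := by
    rw [← pow_mul, ← pow_succ', ← zpow_natCast, ← zpow_natCast, zpow_comm]
  simp_rw [h]
  split_ifs with hd
  · simp [(hζ.zpow_eq_one_iff_dvd d).2 hd]
  · have hne : (ζ ^ d) ^ 2 ≠ 1 := by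
      intro h2
      have h3 : ζ ^ (d * 2) = 1 := by
        rw [zpow_mul]
        exact_mod_cast h2
      refine hd (IsCoprime.dvd_of_dvd_mul_right ?_ ((hζ.zpow_eq_one_iff_dvd _).1 h3))
      exact_mod_cast Nat.isCoprime_iff_coprime.2 hN.coprime_two_right
    have hN1 : ((ζ ^ d) ^ 2) ^ N = 1 := by
      rw [← pow_mul, ← zpow_natCast, zpow_comm, zpow_natCast, mul_comm, pow_mul, hζ.pow_eq_one]
      simp
    rw [← Finset.mul_sum, geom_sum_eq hne, hN1]
    simp

/-- The sum of `(2 cos ((2t+1)π/N)) ^ (2n)` over a full period, for `N` odd. -/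
theorem sum_two_mul_cos_odd_pow {N : ℕ} (hN : Odd N) (n : ℕ) :
    ∑ t ∈ Finset.range N, (2 * Real.cos ((2 * t + 1) * π / N)) ^ (2 * n) =
      N * ∑ k ∈ Finset.range (2 * n + 1),
        if (N : ℤ) ∣ (k : ℤ) - n then ((2 * n).choose k : ℝ) else 0 := by
  have hζ := Complex.isPrimitiveRoot_exp N hN.pos.ne'
  have key : ∑ t ∈ Finset.range N, (2 * Complex.cos ((2 * t + 1) * π / N)) ^ (2 * n) =
      N * ∑ k ∈ Finset.range (2 * n + 1),
        if (N : ℤ) ∣ (k : ℤ) - n then ((2 * n).choose k : ℂ) else 0 := by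
    have hexp (t : ℕ) : Complex.exp (2 * ((2 * t + 1) * π / N) * Complex.I) =
        Complex.exp (2 * π * Complex.I / N) ^ (2 * t + 1) := by
      rw [← Complex.exp_nat_mul]
      congr 1
      push_cast
      ring
    simp_rw [two_mul_cos_pow_eq_sum, hexp]
    rw [Finset.sum_comm, Finset.mul_sum]
    refine Finset.sum_congr rfl fun k _ => ?_
    rw [← Finset.mul_sum, hζ.sum_odd_pow_zpow hN]
    split_ifs <;> ring
  apply Complex.ofReal_injective
  push_cast [apply_ite Complex.ofReal]
  exact key

/-- Folding a full period of `(2 cos ((2t+1)π/(2m+1))) ^ (2n)` onto its first half. -/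
theorem sum_two_mul_cos_odd_pow_fold (m n : ℕ) :
    ∑ t ∈ Finset.range (2 * m + 1),
        (2 * Real.cos ((2 * t + 1) * π / (2 * m + 1))) ^ (2 * n) =
      2 * ∑ t ∈ Finset.range m, (2 * Real.cos ((2 * t + 1) * π / (2 * m + 1))) ^ (2 * n) +
        4 ^ n := by
  have hm : (2 * m + 1 : ℝ) ≠ 0 := by positivity
  have hmid : (2 * Real.cos ((2 * m + 1) * π / (2 * m + 1))) ^ (2 * n) = 4 ^ n := by
    rw [mul_div_cancel_left₀ _ hm, Real.cos_pi, pow_mul]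
    norm_num
  rw [show 2 * m + 1 = (m + 1) + m by ring, Finset.sum_range_add, Finset.sum_range_succ, hmid,
    ← Finset.sum_range_reflect (fun x => (2 * Real.cos ((2 * ((m + 1 + x : ℕ) : ℝ) + 1) * π /
      (2 * m + 1))) ^ (2 * n)) m]
  have hrefl : ∀ t ∈ Finset.range m,
      (2 * Real.cos ((2 * ((m + 1 + (m - 1 - t) : ℕ) : ℝ) + 1) * π / (2 * m + 1))) ^ (2 * n) =
        (2 * Real.cos ((2 * t + 1) * π / (2 * m + 1))) ^ (2 * n) := by
    intro t ht
    have ht' : t < m := Finset.mem_range.1 ht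
    have hc : ((m + 1 + (m - 1 - t) : ℕ) : ℝ) = 2 * m - t := by
      rw [show m + 1 + (m - 1 - t) = 2 * m - t by omega, Nat.cast_sub (by omega)]
      push_cast
      ring
    have harg : (2 * (2 * m - t : ℝ) + 1) * π / (2 * m + 1) =
        2 * π - (2 * t + 1) * π / (2 * m + 1) := by
      field_simp
      ring
    rw [hc, harg, Real.cos_two_pi_sub]
  rw [Finset.sum_congr rfl hrefl]
  ring

/-- Folding a sum of central-symmetric binomial coefficients along a residue class. -/
theorem sum_choose_dvd_sub_eq {N : ℕ} (hN : 0 < N) (n : ℕ) :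
    (∑ k ∈ Finset.range (2 * n + 1),
        if (N : ℤ) ∣ (k : ℤ) - n then ((2 * n).choose k : ℝ) else 0) =
      (2 * n).choose n +
        2 * ∑ j ∈ (Finset.Icc 1 n).filter (fun j => N * j ≤ n),
          ((2 * n).choose (n + N * j) : ℝ) := by
  have hupper : (∑ i ∈ Finset.range n, if (N : ℤ) ∣ ((n + 1 + i : ℕ) : ℤ) - n then
        ((2 * n).choose (n + 1 + i) : ℝ) else 0) =
      ∑ j ∈ (Finset.Icc 1 n).filter (fun j => N * j ≤ n), ((2 * n).choose (n + N * j) : ℝ) := by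
    rw [← Finset.sum_filter]
    symm
    refine Finset.sum_bij (fun j _ => N * j - 1) ?_ ?_ ?_ ?_
    · intro j hj
      simp only [Finset.mem_filter, Finset.mem_Icc, Finset.mem_range] at hj ⊢
      have : 0 < N * j := Nat.mul_pos hN (by omega)
      refine ⟨by omega, j, ?_⟩
      rw [show n + 1 + (N * j - 1) = n + N * j by omega]
      push_cast
      ring
    · intro a ha b hb hab
      simp only [Finset.mem_filter, Finset.mem_Icc] at ha hb
      have h1 : 0 < N * a := Nat.mul_pos hN (by omega)
      have h2 : 0 < N * b := Nat.mul_pos hN (by omega)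
      exact Nat.eq_of_mul_eq_mul_left hN (by omega)
    · intro i hi
      simp only [Finset.mem_filter, Finset.mem_range] at hi
      have hdvd : N ∣ i + 1 := by
        have := hi.2
        rw [show ((n + 1 + i : ℕ) : ℤ) - n = ((i + 1 : ℕ) : ℤ) by push_cast; ring] at this
        exact_mod_cast this
      obtain ⟨j, hj⟩ := hdvd
      have hj0 : 0 < j := Nat.pos_of_ne_zero (by rintro rfl; simp at hj)
      have hjN : j ≤ N * j := Nat.le_mul_of_pos_left j hN
      refine ⟨j, ?_, by omega⟩
      simp only [Finset.mem_filter, Finset.mem_Icc]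
      omega
    · intro j hj
      simp only [Finset.mem_filter, Finset.mem_Icc] at hj
      have : 0 < N * j := Nat.mul_pos hN (by omega)
      rw [show n + 1 + (N * j - 1) = n + N * j by omega]
  have hlower : (∑ k ∈ Finset.range n, if (N : ℤ) ∣ (k : ℤ) - n then
        ((2 * n).choose k : ℝ) else 0) =
      ∑ i ∈ Finset.range n, if (N : ℤ) ∣ ((n + 1 + i : ℕ) : ℤ) - n then
        ((2 * n).choose (n + 1 + i) : ℝ) else 0 := by
    rw [← Finset.sum_range_reflect]
    refine Finset.sum_congr rfl fun i hi => ?_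
    have hi' : i < n := Finset.mem_range.1 hi
    have hsymm : (2 * n).choose (n - 1 - i) = (2 * n).choose (n + 1 + i) :=
      Nat.choose_symm_of_eq_add (by omega)
    have hneg : ((n - 1 - i : ℕ) : ℤ) - n = -(((n + 1 + i : ℕ) : ℤ) - n) := by omega
    simp only [hsymm, hneg, dvd_neg]
  have hsplit : 2 * n + 1 = (n + 1) + n := by ring
  rw [hsplit, Finset.sum_range_add, Finset.sum_range_succ, hlower, hupper]
  simp only [sub_self, dvd_zero, if_true]
  ring

theorem generalized_lucas_even_eq (m : ℕ) (hm : 1 ≤ m) (n : ℕ) :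
    ∑ t ∈ Finset.range m, (2 * Real.cos ((2 * t + 1) * π / (2 * m + 1))) ^ (2 * n) =
      ((2 * m + 1) / 2 : ℝ) * Nat.choose (2 * n) n - (2 : ℝ) ^ (2 * (n : ℤ) - 1) +
        (2 * m + 1) *
          ∑ j ∈ (Finset.Icc 1 n).filter (fun j => (2 * m + 1) * j ≤ n),
            (Nat.choose (2 * n) (n + (2 * m + 1) * j) : ℝ) := by
  have hfull := sum_two_mul_cos_odd_pow (odd_two_mul_add_one m) n
  rw [sum_choose_dvd_sub_eq (odd_two_mul_add_one m).pos] at hfull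
  push_cast at hfull
  rw [sum_two_mul_cos_odd_pow_fold] at hfull
  have hpow : (2 : ℝ) ^ (2 * (n : ℤ) - 1) = 4 ^ n / 2 := by
    rw [zpow_sub₀ two_ne_zero, zpow_mul, zpow_natCast]
    norm_num
  rw [hpow]
  linarith
end

section
/- For every natural number n, the real number X_n = (1/2)·((2+√3)^n + (2−√3)^n) satisfies both X_n = C(2n, n) − Σ_{j=1}^{⌊n/2⌋} (−1)^j · C(2n, n+2j) + 3·Σ_{j=1}^{⌊n/6⌋} (−1)^j · C(2n, n+6j) and X_n = C(2n, n) + Σ_{j=1}^{⌊n/2⌋} C(2n, n+2j) · 2·cos(jπ/3). -/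
open Real

theorem two_mul_cos_pow_two_mul_eq_sum_range (θ : ℝ) (n : ℕ) :
    (2 * cos θ) ^ (2 * n) =
      ∑ k ∈ Finset.range (2 * n + 1), ((2 * n).choose k : ℝ) * cos (2 * ((k : ℝ) - n) * θ) := by
  have h : (2 * Complex.cos θ) ^ (2 * n) = ∑ k ∈ Finset.range (2 * n + 1),
      ((2 * n).choose k : ℂ) * Complex.exp ((2 * ((k : ℝ) - n) * θ : ℝ) * Complex.I) := by
    rw [Complex.two_cos, add_pow]
    refine Finset.sum_congr rfl fun k hk => ?_
    have hk' : k ≤ 2 * n := Nat.lt_succ_iff.mp (Finset.mem_range.mp hk)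
    rw [← Complex.exp_nat_mul, ← Complex.exp_nat_mul, ← Complex.exp_add, mul_comm]
    congr 2
    push_cast [Nat.cast_sub hk']
    ring
  have h' := congrArg Complex.re h
  rw [Complex.re_sum] at h'
  simp only [← Complex.ofReal_natCast, Complex.re_ofReal_mul, Complex.exp_ofReal_mul_I_re] at h'
  rw [← h', ← Complex.ofReal_re ((2 * cos θ) ^ (2 * n))]
  push_cast
  rfl

theorem Finset.sum_range_two_mul_add_one {M : Type*} [AddCommMonoid M] (f : ℕ → M) (n : ℕ) :
    ∑ k ∈ Finset.range (2 * n + 1), f k =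
      f n + ∑ j ∈ Finset.Icc 1 n, (f (n + j) + f (n - j)) := by
  have hIcc (g : ℕ → M) : ∑ j ∈ Finset.Icc 1 n, g j = ∑ j ∈ Finset.range n, g (j + 1) := by
    rw [Finset.range_eq_Ico, Finset.sum_Ico_add' g 0 n 1]
    rfl
  rw [show 2 * n + 1 = n + (n + 1) by ring, Finset.sum_range_add, Finset.sum_range_succ',
    hIcc, Finset.sum_add_distrib, ← Finset.sum_range_reflect f n]
  simp only [add_zero, Nat.sub_sub, Nat.add_comm 1]
  abel

theorem two_mul_cos_pow_two_mul (θ : ℝ) (n : ℕ) :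
    (2 * cos θ) ^ (2 * n) = (2 * n).choose n +
      2 * ∑ j ∈ Finset.Icc 1 n, ((2 * n).choose (n + j) : ℝ) * cos (2 * j * θ) := by
  rw [two_mul_cos_pow_two_mul_eq_sum_range, Finset.sum_range_two_mul_add_one, Finset.mul_sum]
  congr 1
  · simp
  refine Finset.sum_congr rfl fun j hj => ?_
  have hj' : j ≤ n := (Finset.mem_Icc.mp hj).2
  rw [← Nat.choose_symm_of_eq_add (show 2 * n = (n + j) + (n - j) by omega)]
  push_cast [Nat.cast_sub hj']
  rw [show 2 * ((n : ℝ) + j - n) * θ = 2 * j * θ by ring,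
    show 2 * ((n : ℝ) - j - n) * θ = -(2 * j * θ) by ring, cos_neg]
  ring

theorem Finset.sum_Icc_one_eq_sum_mul {M : Type*} [AddCommMonoid M] (a : ℕ → M) {d : ℕ}
    (hd : 0 < d) (n : ℕ) (ha : ∀ j, ¬ d ∣ j → a j = 0) :
    ∑ j ∈ Finset.Icc 1 n, a j = ∑ j ∈ Finset.Icc 1 (n / d), a (d * j) := by
  symm
  refine Finset.sum_of_injOn (d * ·) (fun x _ y _ h => Nat.eq_of_mul_eq_mul_left hd h) ?_ ?_
    fun _ _ => rfl
  · intro j hj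
    simp only [Finset.coe_Icc, Set.mem_Icc] at hj ⊢
    exact ⟨Nat.mul_pos hd hj.1, by rw [mul_comm]; exact (Nat.le_div_iff_mul_le hd).mp hj.2⟩
  · intro j hj hj'
    refine ha j fun ⟨k, hk⟩ => hj' ⟨k, ?_, hk.symm⟩
    subst hk
    simp only [Finset.coe_Icc, Set.mem_Icc, Finset.mem_Icc] at hj ⊢
    exact ⟨Nat.pos_of_mul_pos_left hj.1, (Nat.le_div_iff_mul_le hd).mpr (by linarith [hj.2])⟩

theorem two_mul_cos_nat_mul_pi_div_three (j : ℕ) :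
    2 * cos (j * π / 3) = -(-1) ^ j + 3 * (if 3 ∣ j then (-1 : ℝ) ^ j else 0) := by
  obtain ⟨k, r, hr, rfl⟩ : ∃ k r, r < 3 ∧ j = 3 * k + r :=
    ⟨j / 3, j % 3, Nat.mod_lt _ (by norm_num), (Nat.div_add_mod j 3).symm⟩
  have hcos : cos (((3 * k + r : ℕ) : ℝ) * π / 3) = (-1) ^ k * cos (r * π / 3) := by
    rw [← cos_add_nat_mul_pi]
    congr 1
    push_cast
    ring
  have hpow : (-1 : ℝ) ^ (3 * k) = (-1) ^ k := by rw [pow_mul]; norm_num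
  have hcos2 : cos (2 * π / 3) = -(1 / 2) := by
    rw [show 2 * π / 3 = π - π / 3 by ring, cos_pi_sub, cos_pi_div_three]
  rw [hcos, pow_add, hpow]
  interval_cases r
  · simp; ring
  · rw [if_neg (by omega)]; simp; ring
  · rw [if_neg (by omega)]; push_cast; rw [hcos2]; ring

theorem two_mul_cos_pi_div_twelve_sq : (2 * cos (π / 12)) ^ 2 = 2 + √3 := by
  rw [mul_pow, cos_sq, show 2 * (π / 12) = π / 6 by ring, cos_pi_div_six]
  ring

theorem two_mul_cos_five_mul_pi_div_twelve_sq : (2 * cos (5 * π / 12)) ^ 2 = 2 - √3 := by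
  rw [mul_pow, cos_sq, show 2 * (5 * π / 12) = π - π / 6 by ring, cos_pi_sub, cos_pi_div_six]
  ring

theorem pell_X_eq_sum_cos (n : ℕ) :
    (1 / 2 : ℝ) * ((2 + √3) ^ n + (2 - √3) ^ n) = (2 * n).choose n +
      ∑ j ∈ Finset.Icc 1 (n / 2), ((2 * n).choose (n + 2 * j) : ℝ) * (2 * cos (j * π / 3)) := by
  have hterm (j : ℕ) : cos (2 * j * (π / 12)) + cos (2 * j * (5 * π / 12)) =
      (1 + (-1) ^ j) * cos (j * π / 6) := by
    rw [show 2 * (j : ℝ) * (5 * π / 12) = j * π - j * π / 6 by ring, cos_nat_mul_pi_sub,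
      show 2 * (j : ℝ) * (π / 12) = j * π / 6 by ring]
    ring
  have hsum : (1 / 2 : ℝ) * ((2 + √3) ^ n + (2 - √3) ^ n) = (2 * n).choose n +
      ∑ j ∈ Finset.Icc 1 n,
        ((2 * n).choose (n + j) : ℝ) * ((1 + (-1) ^ j) * cos (j * π / 6)) := by
    simp only [← hterm, mul_add, Finset.sum_add_distrib]
    rw [← two_mul_cos_pi_div_twelve_sq, ← two_mul_cos_five_mul_pi_div_twelve_sq, ← pow_mul,
      ← pow_mul, two_mul_cos_pow_two_mul, two_mul_cos_pow_two_mul]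
    ring
  rw [hsum, Finset.sum_Icc_one_eq_sum_mul _ two_pos]
  · congr 1
    refine Finset.sum_congr rfl fun j _ => ?_
    rw [pow_mul, neg_one_sq, one_pow]
    push_cast
    rw [show 2 * (j : ℝ) * π / 6 = j * π / 3 by ring]
    ring
  · intro j hj
    rw [(Nat.not_even_iff_odd.mp (mt even_iff_two_dvd.mp hj)).neg_one_pow]
    simp

theorem pell_X_eq (n : ℕ) :
    (1 / 2 : ℝ) * ((2 + Real.sqrt 3) ^ n + (2 - Real.sqrt 3) ^ n) =
        Nat.choose (2 * n) n -
          (∑ j ∈ Finset.Icc 1 (n / 2), (-1 : ℝ) ^ j * Nat.choose (2 * n) (n + 2 * j)) +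
          3 * ∑ j ∈ Finset.Icc 1 (n / 6), (-1 : ℝ) ^ j * Nat.choose (2 * n) (n + 6 * j) ∧
      (1 / 2 : ℝ) * ((2 + Real.sqrt 3) ^ n + (2 - Real.sqrt 3) ^ n) =
        Nat.choose (2 * n) n +
          ∑ j ∈ Finset.Icc 1 (n / 2),
            (Nat.choose (2 * n) (n + 2 * j) : ℝ) * (2 * Real.cos (j * π / 3)) := by
  refine ⟨?_, pell_X_eq_sum_cos n⟩
  have hsix : ∑ j ∈ Finset.Icc 1 (n / 6), (-1 : ℝ) ^ j * Nat.choose (2 * n) (n + 6 * j) =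
      ∑ j ∈ Finset.Icc 1 (n / 2),
        (if 3 ∣ j then (-1 : ℝ) ^ j else 0) * Nat.choose (2 * n) (n + 2 * j) := by
    symm
    rw [Finset.sum_Icc_one_eq_sum_mul _ three_pos, Nat.div_div_eq_div_mul]
    · refine Finset.sum_congr rfl fun j _ => ?_
      rw [if_pos (dvd_mul_right 3 j), pow_mul, ← mul_assoc]
      norm_num
    · intro j hj
      rw [if_neg hj, zero_mul]
  rw [pell_X_eq_sum_cos, hsix, sub_add, sub_eq_add_neg, Finset.mul_sum,
    ← Finset.sum_sub_distrib, ← Finset.sum_neg_distrib]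
  congr 1
  refine Finset.sum_congr rfl fun j _ => ?_
  rw [two_mul_cos_nat_mul_pi_div_three]
  ring
end

section
/- For every natural number n, the real number Y_n = (1/(2√3))·((2+√3)^n − (2−√3)^n) satisfies Y_n = Σ_{j≥0} (−1)^j · (C(2n, n+6j+1) − C(2n, n+6j+5)), where the sum is over all j ≥ 0 with 6j+1 ≤ n (all further terms vanish). -/
theorem choose_add_four (m a : ℕ) :
    (m + 4).choose (a + 4) = m.choose a + 4 * m.choose (a + 1) + 6 * m.choose (a + 2) +
      4 * m.choose (a + 3) + m.choose (a + 4) := by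
  simp only [Nat.choose_succ_succ']
  ring

/-- The alternating sum of binomial coefficients truncated to its first `N` terms. -/
def alternatingChooseSum (N n : ℕ) : ℝ :=
  ∑ j ∈ Finset.range N, (-1 : ℝ) ^ j *
    ((Nat.choose (2 * n) (n + 6 * j + 1) : ℝ) - Nat.choose (2 * n) (n + 6 * j + 5))

theorem alternatingChooseSum_telescope (N n : ℕ) :
    alternatingChooseSum N (n + 3) - 4 * alternatingChooseSum N (n + 2) +
        alternatingChooseSum N (n + 1) =
      ((2 * n + 2).choose n : ℝ) - (2 * n + 2).choose (n + 2) -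
        (-1) ^ N * (((2 * n + 2).choose (n + 6 * N) : ℝ) -
          (2 * n + 2).choose (n + 6 * N + 2)) := by
  induction N with
  | zero => simp [alternatingChooseSum]
  | succ N ih =>
    simp only [alternatingChooseSum, Finset.sum_range_succ] at ih ⊢
    have four (a : ℕ) : ((2 * (n + 3)).choose (a + 4) : ℝ) =
        (2 * n + 2).choose a + 4 * (2 * n + 2).choose (a + 1) + 6 * (2 * n + 2).choose (a + 2) +
          4 * (2 * n + 2).choose (a + 3) + (2 * n + 2).choose (a + 4) := by
      exact_mod_cast choose_add_four (2 * n + 2) a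
    have two (a : ℕ) : ((2 * (n + 2)).choose (a + 2) : ℝ) =
        (2 * n + 2).choose a + 2 * (2 * n + 2).choose (a + 1) + (2 * n + 2).choose (a + 2) := by
      rw [show 2 * (n + 2) = 2 * n + 2 + 1 + 1 by ring]
      simp only [Nat.choose_succ_succ']
      push_cast
      ring
    rw [show n + 3 + 6 * N + 1 = n + 6 * N + 4 by ring,
      show n + 3 + 6 * N + 5 = n + 6 * N + 4 + 4 by ring,
      show n + 2 + 6 * N + 1 = n + 6 * N + 1 + 2 by ring,
      show n + 2 + 6 * N + 5 = n + 6 * N + 5 + 2 by ring,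
      show n + 1 + 6 * N + 1 = n + 6 * N + 2 by ring,
      show n + 1 + 6 * N + 5 = n + 6 * N + 6 by ring,
      show n + 6 * (N + 1) = n + 6 * N + 6 by ring, four, four, two, two,
      show 2 * (n + 1) = 2 * n + 2 by ring, pow_succ]
    linear_combination ih

theorem alternatingChooseSum_recurrence {N n : ℕ} (h : n + 3 < N) :
    alternatingChooseSum N (n + 3) =
      4 * alternatingChooseSum N (n + 2) - alternatingChooseSum N (n + 1) := by
  have key := alternatingChooseSum_telescope N n
  rw [Nat.choose_eq_zero_of_lt (show 2 * n + 2 < n + 6 * N by omega),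
    Nat.choose_eq_zero_of_lt (show 2 * n + 2 < n + 6 * N + 2 by omega),
    Nat.choose_symm_of_eq_add (show 2 * n + 2 = n + (n + 2) by ring)] at key
  linear_combination key

theorem alternatingChooseSum_of_le_two {N n : ℕ} (hN : 0 < N) (hn : n ≤ 2) :
    alternatingChooseSum N n = (2 * n).choose (n + 1) := by
  rw [alternatingChooseSum, Finset.sum_eq_single_of_mem 0 (Finset.mem_range.2 hN)]
  · simp [Nat.choose_eq_zero_of_lt (show 2 * n < n + 5 by omega)]
  · intro j _ hj
    simp [Nat.choose_eq_zero_of_lt (show 2 * n < n + 6 * j + 1 by omega),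
      Nat.choose_eq_zero_of_lt (show 2 * n < n + 6 * j + 5 by omega)]

theorem alternatingChooseSum_eq {N : ℕ} :
    ∀ n < N, alternatingChooseSum N n =
      (1 / (2 * Real.sqrt 3)) * ((2 + Real.sqrt 3) ^ n - (2 - Real.sqrt 3) ^ n)
  | 0, h => by simp [alternatingChooseSum_of_le_two h]
  | 1, h => by
    rw [alternatingChooseSum_of_le_two (by omega) (by omega)]
    field_simp
    norm_num
    ring
  | 2, h => by
    rw [alternatingChooseSum_of_le_two (by omega) (by omega)]
    field_simp
    norm_num [Nat.choose]
    ring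
  | n + 3, h => by
    rw [alternatingChooseSum_recurrence h, alternatingChooseSum_eq (n + 2) (by omega),
      alternatingChooseSum_eq (n + 1) (by omega)]
    have hs : Real.sqrt 3 ^ 2 = 3 := Real.sq_sqrt (by norm_num)
    linear_combination (-(1 / (2 * Real.sqrt 3)) *
      ((2 + Real.sqrt 3) ^ (n + 1) - (2 - Real.sqrt 3) ^ (n + 1))) * hs

theorem pell_Y_eq (n : ℕ) :
    (1 / (2 * Real.sqrt 3)) * ((2 + Real.sqrt 3) ^ n - (2 - Real.sqrt 3) ^ n) =
      ∑ j ∈ (Finset.range (n + 1)).filter (fun j => 6 * j + 1 ≤ n),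
        (-1 : ℝ) ^ j *
          ((Nat.choose (2 * n) (n + 6 * j + 1) : ℝ) - Nat.choose (2 * n) (n + 6 * j + 5)) := by
  rw [← alternatingChooseSum_eq n n.lt_succ_self, alternatingChooseSum]
  refine (Finset.sum_filter_of_ne fun j _ hj => ?_).symm
  contrapose! hj
  simp [Nat.choose_eq_zero_of_lt (show 2 * n < n + 6 * j + 1 by omega),
    Nat.choose_eq_zero_of_lt (show 2 * n < n + 6 * j + 5 by omega)]
end

section
/- For every natural number n, 1 + 3·Σ_{1≤k≤n, 3∤k} C(2n, n+k) = 4^n, where the sum is over those k with 1 ≤ k ≤ n that are not divisible by 3. -/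
/-- Summation by parts for the second-order stencil `(1, 2, 1)`. -/
theorem sum_range_mul_stencil (w g : ℕ → ℕ) (N : ℕ) :
    ∑ k ∈ Finset.range N, w (k + 1) * (g k + 2 * g (k + 1) + g (k + 2)) +
        w 0 * g 1 + w (N + 1) * g N =
      w 1 * g 0 + ∑ k ∈ Finset.range N, (w k + 2 * w (k + 1) + w (k + 2)) * g (k + 1) +
        w N * g (N + 1) := by
  induction N with
  | zero => simp; ring
  | succ N ih =>
    rw [Finset.sum_range_succ, Finset.sum_range_succ]
    linarith

theorem choose_two_mul_succ_add (n k : ℕ) :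
    (2 * (n + 1)).choose (n + 1 + (k + 1)) =
      (2 * n).choose (n + k) + 2 * (2 * n).choose (n + (k + 1)) +
        (2 * n).choose (n + (k + 2)) := by
  rw [show 2 * (n + 1) = 2 * n + 1 + 1 by ring, show n + 1 + (k + 1) = n + k + 1 + 1 by ring,
    Nat.choose_succ_succ, Nat.choose_succ_succ, Nat.choose_succ_succ]
  simp only [Nat.succ_eq_add_one, ← add_assoc]
  ring

theorem sum_range_mul_choose_two_mul_succ (w : ℕ → ℕ) {n N : ℕ} (h : n < N) :
    ∑ k ∈ Finset.range N, w (k + 1) * (2 * (n + 1)).choose (n + 1 + (k + 1)) +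
        w 0 * (2 * n).choose (n + 1) =
      w 1 * (2 * n).choose n + ∑ k ∈ Finset.range N,
        (w k + 2 * w (k + 1) + w (k + 2)) * (2 * n).choose (n + (k + 1)) := by
  have key := sum_range_mul_stencil w (fun k => (2 * n).choose (n + k)) N
  have hN : (2 * n).choose (n + N) = 0 := Nat.choose_eq_zero_of_lt (by lia)
  have hN' : (2 * n).choose (n + (N + 1)) = 0 := Nat.choose_eq_zero_of_lt (by lia)
  simpa only [choose_two_mul_succ_add, hN, hN', mul_zero, add_zero] using key

theorem choose_add_two_mul_sum_choose_eq_four_pow {n N : ℕ} (h : n ≤ N) :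
    (2 * n).choose n + 2 * ∑ k ∈ Finset.range N, (2 * n).choose (n + (k + 1)) = 4 ^ n := by
  induction n with
  | zero => simp [Nat.choose_eq_zero_of_lt]
  | succ n ih =>
    have key := sum_range_mul_choose_two_mul_succ (fun _ => 1) (Nat.lt_of_succ_le h)
    have hc : (2 * (n + 1)).choose (n + 1) =
        2 * (2 * n).choose n + 2 * (2 * n).choose (n + 1) := by
      rw [show 2 * (n + 1) = 2 * n + 1 + 1 by ring, Nat.choose_succ_succ,
        ← Nat.choose_symm_half, Nat.choose_succ_succ]
      simp only [Nat.succ_eq_add_one]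
      ring
    simp only [one_mul, ← Finset.mul_sum] at key
    have := ih (by lia)
    rw [hc, pow_succ]
    linarith

theorem one_add_three_mul_sum_range_eq_four_pow {n N : ℕ} (h : n ≤ N) :
    1 + 3 * ∑ k ∈ Finset.range N,
      (if 3 ∣ k + 1 then 0 else 1) * (2 * n).choose (n + (k + 1)) = 4 ^ n := by
  induction n with
  | zero => simp [Nat.choose_eq_zero_of_lt]
  | succ n ih =>
    have key := sum_range_mul_choose_two_mul_succ (fun k => if 3 ∣ k then 0 else 1)
      (Nat.lt_of_succ_le h)
    have hw (k : ℕ) : ((if 3 ∣ k then 0 else 1) + 2 * (if 3 ∣ k + 1 then 0 else 1) +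
        (if 3 ∣ k + 2 then 0 else 1) : ℕ) = 2 + (if 3 ∣ k + 1 then 0 else 1) := by
      split_ifs <;> lia
    simp only [hw, add_mul 2, Finset.sum_add_distrib, ← Finset.mul_sum] at key
    norm_num at key
    have := choose_add_two_mul_sum_choose_eq_four_pow (Nat.le_of_succ_le h)
    have := ih (by lia)
    norm_num at this ⊢
    rw [pow_succ]
    linarith

theorem one_add_three_mul_sum_eq_four_pow (n : ℕ) :
    1 + 3 * ∑ k ∈ (Finset.Icc 1 n).filter (fun k => ¬ 3 ∣ k), Nat.choose (2 * n) (n + k) =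
      4 ^ n := by
  rw [← one_add_three_mul_sum_range_eq_four_pow le_rfl, Finset.sum_filter,
    ← Finset.Ico_add_one_right_eq_Icc, Finset.sum_Ico_eq_sum_range]
  simp only [add_tsub_cancel_right, add_comm 1, ite_not, ite_mul, zero_mul, one_mul]
end
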